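/- Let G be a finite simple graph with maximum degree Δ(G) ≥ 9 that is claw-free, i.e., G contains no induced subgraph isomorphic to the star K_{1,3}. Then χ(G) ≤ max{Δ(G) − 1, ω(G)}. -/

import Mathlib

open SimpleGraph

/-- The claw `K_{1,3}`: the centre `0` is adjacent to the three pairwise
non-adjacent leaves `1, 2, 3`. -/
def clawGraph : SimpleGraph (Fin 4) :=
  SimpleGraph.fromRel (fun a b => (a = 0 ∧ b = 1) ∨ (a = 0 ∧ b = 2) ∨ (a = 0 ∧ b = 3))

namespace BK
set_option linter.unusedSectionVars false
open Classical Finset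

variable {V : Type*} [Fintype V]

/-- Neighbourhood as a finset. -/
noncomputable def nb (G : SimpleGraph V) (v : V) : Finset V := Finset.univ.filter (fun u => G.Adj v u)

lemma mem_nb {G : SimpleGraph V} {v u : V} : u ∈ nb G v ↔ G.Adj v u := by simp [nb]

/-- `c` is proper on the set `A`. -/
def PC (G : SimpleGraph V) {k : ℕ} (A : Finset V) (c : V → Fin k) : Prop :=
  ∀ a ∈ A, ∀ b ∈ A, G.Adj a b → c a ≠ c b

/-- `c` is proper away from `v`. -/
def Tok (G : SimpleGraph V) {k : ℕ} (v : V) (c : V → Fin k) : Prop :=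
  ∀ a b, a ≠ v → b ≠ v → G.Adj a b → c a ≠ c b

/-- A minimal counterexample. -/
structure Crit (G : SimpleGraph V) (k : ℕ) : Prop where
  hk : 8 ≤ k
  claw : ∀ a b c d, G.Adj a b → G.Adj a c → G.Adj a d → b ≠ c → b ≠ d → c ≠ d →
    ¬ G.Adj b c → ¬ G.Adj b d → G.Adj c d
  deg : ∀ v, (nb G v).card ≤ k + 1
  nocol : ∀ c : V → Fin k, ¬ PC G Finset.univ c
  crit : ∀ v, ∃ c : V → Fin k, Tok G v c
  noclq : ∀ s : Finset V, (∀ a ∈ s, ∀ b ∈ s, a ≠ b → G.Adj a b) → s.card ≤ k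

variable {G : SimpleGraph V} {k : ℕ}

lemma ext_base (R : Finset V) : ∀ (A : Finset V) (c : V → Fin k), Disjoint A R → PC G A c →
    (∀ u ∈ R, ((nb G u ∩ A).image c).card + (nb G u ∩ R).card < k) →
    ∃ c' : V → Fin k, PC G (A ∪ R) c' ∧ ∀ a ∈ A, c' a = c a := by
  induction R using Finset.induction_on with
  | empty => intro A c _ h _; exact ⟨c, by simpa using h, fun _ _ => rfl⟩
  | insert u R hu ih =>
    intro A c hd hp h
    have huA : u ∉ A := fun h' => (Finset.disjoint_left.mp hd h') (mem_insert_self _ _)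
    have h1 : ((nb G u ∩ A).image c).card < (Finset.univ : Finset (Fin k)).card := by
      have := h u (mem_insert_self _ _)
      simp only [card_univ, Fintype.card_fin]; omega
    obtain ⟨m, -, hm⟩ := Finset.exists_mem_notMem_of_card_lt_card h1
    have hm' : ∀ a ∈ A, G.Adj u a → c a ≠ m := by
      intro a ha hua he
      exact hm (mem_image.2 ⟨a, mem_inter.2 ⟨mem_nb.2 hua, ha⟩, he⟩)
    have hne : ∀ a ∈ A, a ≠ u := fun a ha e => huA (e ▸ ha)
    obtain ⟨c', hc', hcA⟩ := ih (insert u A) (Function.update c u m) (by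
        rw [Finset.disjoint_left]
        intro a ha haR
        rcases mem_insert.1 ha with rfl | ha
        · exact hu haR
        · exact (Finset.disjoint_left.mp hd ha) (mem_insert_of_mem haR)) (by
        intro a ha b hb hab
        rcases mem_insert.1 ha with rfl | ha' <;> rcases mem_insert.1 hb with rfl | hb'
        · exact absurd hab (G.loopless.irrefl _)
        · simp only [Function.update_self, Function.update_of_ne (hne b hb')]
          exact fun e => hm' b hb' hab e.symm
        · simp only [Function.update_self, Function.update_of_ne (hne a ha')]
          exact fun e => hm' a ha' hab.symm e
        · simp only [Function.update_of_ne (hne a ha'), Function.update_of_ne (hne b hb')]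
          exact hp a ha' b hb' hab) (by
        intro w hw
        have hwu : w ≠ u := fun e => hu (e ▸ hw)
        have := h w (mem_insert_of_mem hw)
        by_cases hadj : G.Adj w u
        · have e1 : nb G w ∩ insert u A = insert u (nb G w ∩ A) :=
            inter_insert_of_mem (mem_nb.2 hadj)
          have e2 : nb G w ∩ insert u R = insert u (nb G w ∩ R) :=
            inter_insert_of_mem (mem_nb.2 hadj)
          have e3 : ((nb G w ∩ A).image (Function.update c u m)) = (nb G w ∩ A).image c := by
            apply image_congr
            intro a ha
            exact Function.update_of_ne (hne a (mem_inter.1 ha).2) _ _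
          rw [e1, image_insert, e3]
          rw [e2, card_insert_of_notMem (by simp [hu])] at this
          have := card_insert_le (Function.update c u m u) ((nb G w ∩ A).image c)
          omega
        · have e1 : nb G w ∩ insert u A = nb G w ∩ A :=
            inter_insert_of_notMem (by simpa [mem_nb] using hadj)
          have e2 : nb G w ∩ insert u R = nb G w ∩ R :=
            inter_insert_of_notMem (by simpa [mem_nb] using hadj)
          have e3 : ((nb G w ∩ A).image (Function.update c u m)) = (nb G w ∩ A).image c := by
            apply image_congr
            intro a ha
            exact Function.update_of_ne (hne a (mem_inter.1 ha).2) _ _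
          rw [e1, e3]; rw [e2] at this; exact this)
    refine ⟨c', ?_, ?_⟩
    · have : insert u A ∪ R = A ∪ insert u R := by ext; simp
      rwa [this] at hc'
    · intro a ha
      rw [hcA a (mem_insert_of_mem ha), Function.update_of_ne (hne a ha)]

/-- Greedy extension: for each `u ∈ R` we exhibit a set `Q` of saved neighbours. -/
lemma ext_save (A R : Finset V) (c : V → Fin k) (hd : Disjoint A R) (hp : PC G A c)
    (h : ∀ u ∈ R, ∃ Q : Finset V, Q ⊆ nb G u ∧ (nb G u).card < k + Q.card ∧
      ∀ q ∈ Q, q ∉ R ∧ (q ∈ A → ∃ a ∈ A, G.Adj u a ∧ a ∉ Q ∧ c a = c q)) :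
    ∃ c' : V → Fin k, PC G (A ∪ R) c' ∧ ∀ a ∈ A, c' a = c a := by
  apply ext_base R A c hd hp
  intro u hu
  obtain ⟨Q, hQ, hc, hs⟩ := h u hu
  have h1 : (nb G u ∩ A).image c ⊆ ((nb G u \ Q) ∩ A).image c := by
    intro m hm
    obtain ⟨q, hq, rfl⟩ := mem_image.1 hm
    rw [mem_inter] at hq
    by_cases hqQ : q ∈ Q
    · obtain ⟨a, ha, hua, haQ, e⟩ := (hs q hqQ).2 hq.2
      exact mem_image.2 ⟨a, by simp [ha, haQ, mem_nb, hua], e⟩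
    · exact mem_image.2 ⟨q, by simp [hq, hqQ], rfl⟩
  have h2 : nb G u ∩ R ⊆ (nb G u \ Q) ∩ R := by
    intro r hr
    rw [mem_inter] at hr
    have : r ∉ Q := fun h => (hs r h).1 hr.2
    simp [hr, this]
  have h3 : ((nb G u \ Q) ∩ A).card + ((nb G u \ Q) ∩ R).card ≤ (nb G u \ Q).card := by
    rw [← card_union_of_disjoint]
    · apply card_le_card
      intro x hx
      simp only [mem_union, mem_inter] at hx
      tauto
    · exact (hd.mono inter_subset_right inter_subset_right)
  have h4 : (nb G u \ Q).card = (nb G u).card - Q.card := card_sdiff_of_subset hQ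
  have h5 := card_le_card h1
  have h6 := card_le_card h2
  have h7 := card_le_card hQ
  have h8 := card_image_le (s := (nb G u \ Q) ∩ A) (f := c)
  omega

/-- every color appears at the uncolored vertex -/
lemma F1 (h : Crit G k) {v : V} {c : V → Fin k} (hc : Tok G v c) (i : Fin k) :
    ∃ x, G.Adj v x ∧ c x = i := by
  by_contra hcon
  push Not at hcon
  apply h.nocol (Function.update c v i)
  intro a _ b _ hab
  by_cases ha : a = v
  · subst ha
    have hb : b ≠ a := hab.ne'
    rw [Function.update_self, Function.update_of_ne hb]
    exact (hcon b hab).symm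
  · by_cases hb : b = v
    · subst hb
      rw [Function.update_self, Function.update_of_ne ha]
      exact (hcon a hab.symm)
    · rw [Function.update_of_ne ha, Function.update_of_ne hb]
      exact hc a b ha hb hab

/-- `x` is the only neighbour of `v` with its color -/
def Sg (G : SimpleGraph V) (v : V) (c : V → Fin k) (x : V) : Prop :=
  G.Adj v x ∧ ∀ y, G.Adj v y → c y = c x → y = x

/-- sliding -/
lemma F3 {v : V} {c : V → Fin k} (hc : Tok G v c) {x : V} (hx : Sg G v c x) :
    Tok G x (Function.update c v (c x)) := by
  intro a b ha hb hab
  by_cases hav : a = v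
  · subst hav
    rw [Function.update_self, Function.update_of_ne hab.ne']
    exact fun e => hb (hx.2 b hab e.symm)
  · by_cases hbv : b = v
    · subst hbv
      rw [Function.update_self, Function.update_of_ne hav]
      exact fun e => ha (hx.2 a hab.symm e)
    · rw [Function.update_of_ne hav, Function.update_of_ne hbv]
      exact hc a b hav hbv hab

lemma F2 (h : Crit G k) {v : V} {c : V → Fin k} (hc : Tok G v c) {x : V} (hx : Sg G v c x)
    {j : Fin k} (hj : j ≠ c x) : ∃ w, G.Adj x w ∧ w ≠ v ∧ c w = j := by
  obtain ⟨w, hw, e⟩ := F1 h (F3 hc hx) j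
  have hwv : w ≠ v := by
    rintro rfl
    rw [Function.update_self] at e
    exact hj e.symm
  rw [Function.update_of_ne hwv] at e
  exact ⟨w, hw, hwv, e⟩

/-- at most one repeated color at a single vertex -/
lemma F4 (h : Crit G k) {v : V} {c : V → Fin k} (hc : Tok G v c) {x : V} (hx : Sg G v c x)
    {a b a' b' : V} (ha : G.Adj x a) (hb : G.Adj x b) (ha' : G.Adj x a') (hb' : G.Adj x b')
    (hav : a ≠ v) (hbv : b ≠ v) (hav' : a' ≠ v) (hbv' : b' ≠ v)
    (hab : a ≠ b) (hab' : a' ≠ b') (e : c a = c b) (e' : c a' = c b') (hne : c a ≠ c a') : False := by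
  have h1 : (Finset.univ.erase (c x) : Finset (Fin k)) ⊆
      (((((nb G x).erase v).erase b).erase b')).image c := by
    intro j hj
    obtain ⟨w, hw, hwv, ew⟩ := F2 h hc hx (j := j) (by simpa using hj)
    by_cases h1 : w = b
    · subst h1
      refine mem_image.2 ⟨a, ?_, by rw [e, ew]⟩
      simp only [mem_erase, mem_nb]
      exact ⟨fun q => hne (by rw [e', q]), hab, hav, ha⟩
    · by_cases h2 : w = b'
      · subst h2
        refine mem_image.2 ⟨a', ?_, by rw [e', ew]⟩
        simp only [mem_erase, mem_nb]
        exact ⟨hab', fun q => hne (by rw [e, q]), hav', ha'⟩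
      · refine mem_image.2 ⟨w, ?_, ew⟩
        simp only [mem_erase, mem_nb]
        exact ⟨h2, h1, hwv, hw⟩
  have h2 := (card_le_card h1).trans card_image_le
  rw [card_erase_of_mem (mem_univ _), card_univ, Fintype.card_fin] at h2
  have hbb : b' ≠ b := fun q => hne (by rw [e, e', q])
  rw [card_erase_of_mem (by simp [mem_nb, hbb, hbv', hb']), card_erase_of_mem (by simp [mem_nb, hbv, hb]),
    card_erase_of_mem (by simp [mem_nb, hx.1.symm])] at h2
  have := h.deg x
  have := h.hk
  omega

/-- local picture around a nonadjacent pair of singles -/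
structure WZ (G : SimpleGraph V) (v : V) (c : V → Fin k) (x y w z : V) : Prop where
  xw : G.Adj x w
  vw : ¬ G.Adj v w
  wv : w ≠ v
  cw : c w = c y
  wu : ∀ w', G.Adj x w' → w' ≠ v → c w' = c y → w' = w
  wz : G.Adj w z
  zx : z ≠ x
  cz : c z = c x
  vz : ¬ G.Adj v z
  zv : z ≠ v
  zu : ∀ z', G.Adj w z' → z' ≠ x → c z' = c x → z' = z

lemma Sg.ne_col {v : V} {c : V → Fin k} {x y : V} (hy : Sg G v c y) (hx : Sg G v c x)
    (hxy : x ≠ y) : c x ≠ c y := fun e => hxy (hy.2 x hx.1 e)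

lemma sgSlide {v : V} {c : V → Fin k} {x y w z : V} (hx : Sg G v c x) (hy : Sg G v c y)
    (hxy : x ≠ y) (h : WZ G v c x y w z) : Sg G x (Function.update c v (c x)) w := by
  refine ⟨h.xw, fun w' hw' e => ?_⟩
  rw [Function.update_of_ne h.wv] at e
  by_cases hw : w' = v
  · subst hw
    rw [Function.update_self, h.cw] at e
    exact absurd e (hy.ne_col hx hxy)
  · rw [Function.update_of_ne hw] at e
    exact h.wu w' hw' hw (e.trans h.cw)

lemma exWZ (h : Crit G k) {v : V} {c : V → Fin k} (hc : Tok G v c) {x y : V} (hx : Sg G v c x)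
    (hy : Sg G v c y) (hxy : x ≠ y) (hadj : ¬ G.Adj x y) : ∃ w z, WZ G v c x y w z := by
  have hcol := hy.ne_col hx hxy
  obtain ⟨w, hw, hwv, ew⟩ := F2 h hc hx hcol.symm
  have key : ∀ w', G.Adj x w' → w' ≠ v → c w' = c y → ¬ G.Adj v w' := by
    intro w' h1 h2 h3 h4
    exact hadj (hy.2 w' h4 h3 ▸ h1)
  have hvw := key w hw hwv ew
  have wu : ∀ w', G.Adj x w' → w' ≠ v → c w' = c y → w' = w := by
    intro w' h1 h2 h3
    by_contra hne
    exact hc w w' hwv h2 (h.claw x v w w' hx.1.symm hw h1 hwv.symm h2.symm (Ne.symm hne) hvw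
      (key w' h1 h2 h3)) (ew.trans h3.symm)
  have hs : Sg G x (Function.update c v (c x)) w := by
    refine ⟨hw, fun w' hw' e => ?_⟩
    rw [Function.update_of_ne hwv] at e
    by_cases hw : w' = v
    · subst hw
      rw [Function.update_self, ew] at e
      exact absurd e hcol
    · rw [Function.update_of_ne hw] at e
      exact wu w' hw' hw (e.trans ew)
  obtain ⟨z, hz, hzx, ez⟩ := F2 h (F3 hc hx) hs (j := c x) (by
    rw [Function.update_of_ne hwv, ew]; exact hcol)
  have hzv : z ≠ v := by rintro rfl; exact hvw hz.symm
  rw [Function.update_of_ne hzv] at ez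
  refine ⟨w, z, hw, hvw, hwv, ew, wu, hz, hzx, ez, fun q => hzx (hx.2 z q ez), hzv, ?_⟩
  intro z' h1 h2 h3
  have hzv' : z' ≠ v := by rintro rfl; exact hvw h1.symm
  have hxv : x ≠ v := hx.1.ne'
  by_contra hne
  exact hc z z' hzv hzv' (h.claw w x z z' hw.symm hz h1 hzx.symm h2.symm (Ne.symm hne)
    (fun q => hc x z hxv hzv q ez.symm) (fun q => hc x z' hxv hzv' q h3.symm)) (ez.trans h3.symm)

lemma path_conn {W : Type*} [Fintype W] (K : SimpleGraph W) (hK : K.Connected)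
    (h2 : ∀ u a b c, K.Adj u a → K.Adj u b → K.Adj u c → a = b ∨ a = c ∨ b = c)
    (x y z : W) (hxy : x ≠ y) (hxz : x ≠ z) (hyz : y ≠ z)
    (h1 : ∀ u, u = x ∨ u = y ∨ u = z → ∀ a b, K.Adj u a → K.Adj u b → a = b) : False := by
  have e1 := hK.card_vert_le_card_edgeSet_add_one
  have e2 := K.sum_degrees_eq_twice_card_edges
  rw [Nat.card_eq_fintype_card, Nat.card_eq_fintype_card, ← edgeFinset_card] at e1
  have d2 : ∀ u, K.degree u ≤ 2 := by
    intro u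
    by_contra hcon
    push Not at hcon
    rw [← card_neighborFinset_eq_degree, Finset.two_lt_card] at hcon
    obtain ⟨a, ha, b, hb, c, hc, n1, n2, n3⟩ := hcon
    rw [mem_neighborFinset] at ha hb hc
    rcases h2 u a b c ha hb hc with h | h | h
    · exact n1 h
    · exact n2 h
    · exact n3 h
  have d1 : ∀ u ∈ ({x, y, z} : Finset W), K.degree u ≤ 1 := by
    intro u hu
    rw [← card_neighborFinset_eq_degree, Finset.card_le_one]
    intro a ha b hb
    rw [mem_neighborFinset] at ha hb
    exact h1 u (by simpa using hu) a b ha hb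
  have c3 : ({x, y, z} : Finset W).card = 3 := by
    rw [card_eq_three]; exact ⟨x, y, z, hxy, hxz, hyz, rfl⟩
  have s1 : ∑ u ∈ ({x, y, z} : Finset W), K.degree u ≤ 3 := by
    have := Finset.sum_le_card_nsmul _ _ 1 d1
    simpa [c3] using this
  have s2 : ∑ u ∈ ({x, y, z} : Finset W)ᶜ, K.degree u ≤ (Fintype.card W - 3) * 2 := by
    have := Finset.sum_le_card_nsmul ({x, y, z} : Finset W)ᶜ (fun u => K.degree u) 2 (fun u _ => d2 u)
    rwa [card_compl, c3, smul_eq_mul] at this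
  have s3 := Finset.sum_add_sum_compl ({x, y, z} : Finset W) (fun u => K.degree u)
  have s4 : 3 ≤ Fintype.card W := by rw [← c3]; exact card_le_univ _
  omega

lemma path_comp (K : SimpleGraph V)
    (h2 : ∀ u a b c, K.Adj u a → K.Adj u b → K.Adj u c → a = b ∨ a = c ∨ b = c)
    (x y z : V) (hxy : x ≠ y) (hxz : x ≠ z) (hyz : y ≠ z) (ry : K.Reachable x y)
    (rz : K.Reachable x z)
    (h1 : ∀ u, u = x ∨ u = y ∨ u = z → ∀ a b, K.Adj u a → K.Adj u b → a = b) : False := by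
  let C := K.connectedComponentMk x
  have mx : x ∈ C.supp := rfl
  have my : y ∈ C.supp := ConnectedComponent.sound ry.symm
  have mz : z ∈ C.supp := ConnectedComponent.sound rz.symm
  refine path_conn (C.toSimpleGraph) C.connected_toSimpleGraph ?_ ⟨x, mx⟩ ⟨y, my⟩ ⟨z, mz⟩
    (by simpa using hxy) (by simpa using hxz) (by simpa using hyz) ?_
  · rintro ⟨u, hu⟩ ⟨a, ha⟩ ⟨b, hb⟩ ⟨c, hc⟩ q1 q2 q3
    have := h2 u a b c q1 q2 q3
    simpa using this
  · rintro ⟨u, hu⟩ hh ⟨a, ha⟩ ⟨b, hb⟩ q1 q2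
    have := h1 u (by simpa using hh) a b q1 q2
    simpa using this

/-- Kempe graph on two colors. -/
def kg (G : SimpleGraph V) (v : V) (c : V → Fin k) (i j : Fin k) : SimpleGraph V where
  Adj a b := G.Adj a b ∧ a ≠ v ∧ b ≠ v ∧ ((c a = i ∧ c b = j) ∨ (c a = j ∧ c b = i))
  symm := ⟨fun a b h => ⟨h.1.symm, h.2.2.1, h.2.1, by tauto⟩⟩
  loopless := ⟨fun a h => G.loopless.irrefl a h.1⟩

/-- swap colors on the Kempe component of `x`. -/
noncomputable def sw (G : SimpleGraph V) (v : V) (c : V → Fin k) (i j : Fin k) (x : V) : V → Fin k :=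
  fun u => if (kg G v c i j).Reachable x u then Equiv.swap i j (c u) else c u

lemma sw_in {v : V} {c : V → Fin k} {i j : Fin k} {x u : V} (h : (kg G v c i j).Reachable x u) :
    sw G v c i j x u = Equiv.swap i j (c u) := if_pos h
lemma sw_out {v : V} {c : V → Fin k} {i j : Fin k} {x u : V} (h : ¬ (kg G v c i j).Reachable x u) :
    sw G v c i j x u = c u := if_neg h

lemma sw_other {v : V} {c : V → Fin k} {i j l : Fin k} {x u : V} (hi : l ≠ i) (hj : l ≠ j) :
    sw G v c i j x u = l ↔ c u = l := by
  by_cases h : (kg G v c i j).Reachable x u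
  · rw [sw_in h, Equiv.swap_apply_eq_iff, Equiv.swap_apply_of_ne_of_ne hi hj]
  · rw [sw_out h]

lemma sw_tok {v : V} {c : V → Fin k} (hc : Tok G v c) (i j : Fin k) (x : V) :
    Tok G v (sw G v c i j x) := by
  have key : ∀ a b, a ≠ v → b ≠ v → G.Adj a b → (kg G v c i j).Reachable x a →
      ¬ (kg G v c i j).Reachable x b → Equiv.swap i j (c a) ≠ c b := by
    intro a b ha hb hab ra rb e
    have hne := hc a b ha hb hab
    have : ¬ (kg G v c i j).Adj a b := fun q => rb (ra.trans q.reachable)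
    apply this
    refine ⟨hab, ha, hb, ?_⟩
    by_cases h1 : c a = i
    · left; rw [h1, Equiv.swap_apply_left] at e; exact ⟨h1, e.symm⟩
    · by_cases h2 : c a = j
      · right; rw [h2, Equiv.swap_apply_right] at e; exact ⟨h2, e.symm⟩
      · rw [Equiv.swap_apply_of_ne_of_ne h1 h2] at e; exact absurd e hne
  intro a b ha hb hab
  by_cases ra : (kg G v c i j).Reachable x a <;> by_cases rb : (kg G v c i j).Reachable x b
  · rw [sw_in ra, sw_in rb]
    exact fun e => hc a b ha hb hab ((Equiv.swap i j).injective e)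
  · rw [sw_in ra, sw_out rb]; exact key a b ha hb hab ra rb
  · rw [sw_out ra, sw_in rb]; exact fun e => key b a hb ha hab.symm rb ra e.symm
  · rw [sw_out ra, sw_out rb]; exact hc a b ha hb hab

lemma F5 (h : Crit G k) {v : V} {c : V → Fin k} (hc : Tok G v c) {x y : V} (hx : Sg G v c x)
    (hy : Sg G v c y) : (kg G v c (c x) (c y)).Reachable x y := by
  by_contra hcon
  obtain ⟨u, hu, e⟩ := F1 h (sw_tok hc (c x) (c y) x) (c x)
  by_cases r : (kg G v c (c x) (c y)).Reachable x u
  · rw [sw_in r, Equiv.swap_apply_eq_iff, Equiv.swap_apply_left] at e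
    exact hcon (hy.2 u hu e ▸ r)
  · rw [sw_out r] at e
    exact r (hx.2 u hu e ▸ Reachable.refl _)

/-- interior vertices of Kempe paths have two neighbours -/
lemma two_nb (h : Crit G k) {v : V} {c : V → Fin k} (hc : Tok G v c) {x y : V} (hx : Sg G v c x)
    (hy : Sg G v c y) (hxy : x ≠ y) (hadj : ¬ G.Adj x y) {z : V}
    (hz : (kg G v c (c x) (c y)).Reachable x z) (cz : c z = c x) (hzx : z ≠ x) :
    ∃ a b, a ≠ b ∧ G.Adj z a ∧ G.Adj z b ∧ c a = c y ∧ c b = c y ∧ a ≠ v ∧ b ≠ v := by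
  have hcol := hy.ne_col hx hxy
  have key : ∀ u a, (kg G v c (c x) (c y)).Adj u a → c u = c x → c a = c y := by
    intro u a q e
    rcases q.2.2.2 with q | q
    · exact q.2
    · exact absurd (e.symm.trans q.1) hcol
  have key' : ∀ u a, (kg G v c (c x) (c y)).Adj u a → c u = c y → c a = c x := by
    intro u a q e
    rcases q.2.2.2 with q | q
    · exact absurd (q.1.symm.trans e) hcol
    · exact q.2
  by_contra hcon
  refine path_comp (kg G v c (c x) (c y)) ?_ x y z hxy hzx.symm (fun e => hcol (by rw [← cz, e]))
    (F5 h hc hx hy) hz ?_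
  · intro u a b d ha hb hd
    by_contra hne
    push Not at hne
    have hav := ha.2.2.1
    have hbv := hb.2.2.1
    have hdv := hd.2.2.1
    have same : c a = c b ∧ c a = c d := by
      rcases ha.2.2.2 with q | q
      · have e1 := key u a ha q.1
        have e2 := key u b hb q.1
        have e3 := key u d hd q.1
        exact ⟨e1.trans e2.symm, e1.trans e3.symm⟩
      · have e1 := key' u a ha q.1
        have e2 := key' u b hb q.1
        have e3 := key' u d hd q.1
        exact ⟨e1.trans e2.symm, e1.trans e3.symm⟩
    exact hc b d hbv hdv (h.claw u a b d ha.1 hb.1 hd.1 hne.1 hne.2.1 hne.2.2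
      (fun q => hc a b hav hbv q same.1) (fun q => hc a d hav hdv q same.2))
      (same.1.symm.trans same.2)
  · rintro u (rfl | rfl | rfl) a b ha hb
    · obtain ⟨w, z', hw⟩ := exWZ h hc hx hy hxy hadj
      rw [hw.wu a ha.1 ha.2.2.1 (key _ _ ha rfl), hw.wu b hb.1 hb.2.2.1 (key _ _ hb rfl)]
    · obtain ⟨w, z', hw⟩ := exWZ h hc hy hx hxy.symm (fun q => hadj q.symm)
      rw [hw.wu a ha.1 ha.2.2.1 (key' _ _ ha rfl), hw.wu b hb.1 hb.2.2.1 (key' _ _ hb rfl)]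
    · by_contra hne
      exact hcon ⟨a, b, hne, ha.1, hb.1, key _ _ ha cz, key _ _ hb cz, ha.2.2.1, hb.2.2.1⟩

lemma WZ.reach_w {v : V} {c : V → Fin k} {x y w z : V} (hx : Sg G v c x) (h : WZ G v c x y w z) :
    (kg G v c (c x) (c y)).Reachable x w :=
  Adj.reachable ⟨h.xw, hx.1.ne', h.wv, Or.inl ⟨rfl, h.cw⟩⟩

lemma WZ.reach_z {v : V} {c : V → Fin k} {x y w z : V} (hx : Sg G v c x) (h : WZ G v c x y w z) :
    (kg G v c (c x) (c y)).Reachable x z :=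
  (h.reach_w hx).trans (Adj.reachable ⟨h.wz, h.wv, h.zv, Or.inr ⟨h.cw, h.cz⟩⟩)

lemma zeq (h : Crit G k) {v : V} {c : V → Fin k} (hc : Tok G v c) {x y y' w z w' z' : V}
    (hx : Sg G v c x) (hy : Sg G v c y) (hy' : Sg G v c y') (hxy : x ≠ y) (hxy' : x ≠ y')
    (hyy : y ≠ y') (hadj : ¬ G.Adj x y) (hadj' : ¬ G.Adj x y')
    (hw : WZ G v c x y w z) (hw' : WZ G v c x y' w' z') :
    z' = z ∨ ∃ a b, a ≠ b ∧ G.Adj w' a ∧ G.Adj w' b ∧ c a = c y ∧ c b = c y := by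
  have cxy := hy.ne_col hx hxy
  have cxy' := hy'.ne_col hx hxy'
  have cyy := hy'.ne_col hy hyy
  have hww : w ≠ w' := fun e => cyy (by rw [← hw.cw, ← hw'.cw, e])
  have aww : G.Adj w' w :=
    (h.claw x v w w' hx.1.symm hw.xw hw'.xw hw.wv.symm hw'.wv.symm hww hw.vw hw'.vw).symm
  by_contra hcon
  push Not at hcon
  obtain ⟨hz, hun⟩ := hcon
  have hun' : ∀ a, G.Adj w' a → c a = c y → a = w := by
    intro a ha e
    by_contra hne
    exact hun a w hne ha aww e hw.cw
  have ry := F5 h hc hx hy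
  have hcol1 : sw G v c (c x) (c y) x x = c y := by
    rw [sw_in (Reachable.refl _), Equiv.swap_apply_left]
  have hcol2 : sw G v c (c x) (c y) x y' = c y' := (sw_other cxy'.symm cyy.symm).2 rfl
  have sx : Sg G v (sw G v c (c x) (c y) x) x := by
    refine ⟨hx.1, fun u hu e => ?_⟩
    rw [hcol1] at e
    by_cases r : (kg G v c (c x) (c y)).Reachable x u
    · rw [sw_in r, Equiv.swap_apply_eq_iff, Equiv.swap_apply_right] at e
      exact hx.2 u hu e
    · rw [sw_out r] at e
      exact absurd (hy.2 u hu e ▸ ry) r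
  have sy' : Sg G v (sw G v c (c x) (c y) x) y' := by
    refine ⟨hy'.1, fun u hu e => ?_⟩
    rw [hcol2, sw_other cxy'.symm cyy.symm] at e
    exact hy'.2 u hu e
  obtain ⟨w₂, z₂, h₂⟩ := exWZ h (sw_tok hc _ _ _) sx sy' hxy' hadj'
  have ew : w₂ = w' := by
    have := h₂.cw
    rw [hcol2, sw_other cxy'.symm cyy.symm] at this
    exact hw'.wu w₂ h₂.xw h₂.wv this
  subst ew
  have ez := h₂.cz
  rw [hcol1] at ez
  by_cases r : (kg G v c (c x) (c y)).Reachable x z₂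
  · rw [sw_in r, Equiv.swap_apply_eq_iff, Equiv.swap_apply_right] at ez
    have e2 : z₂ = z' := hw'.zu z₂ h₂.wz h₂.zx ez
    subst e2
    obtain ⟨a, b, hab, ha, hb, ca, cb, hav, hbv⟩ := two_nb h hc hx hy hxy hadj r ez h₂.zx
    have hz2 : ¬ G.Adj w z₂ := fun q => hz (hw.zu z₂ q h₂.zx ez)
    have caw : ¬ G.Adj w₂ a := fun q => hz2 (hun' a q ca ▸ ha.symm)
    have cbw : ¬ G.Adj w₂ b := fun q => hz2 (hun' b q cb ▸ hb.symm)
    have n1 : w₂ ≠ a := fun e => cyy (by rw [← ca, ← hw'.cw, e])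
    have n2 : w₂ ≠ b := fun e => cyy (by rw [← cb, ← hw'.cw, e])
    exact hc a b hav hbv (h.claw z₂ w₂ a b h₂.wz.symm ha hb n1 n2 hab caw cbw) (ca.trans cb.symm)
  · rw [sw_out r] at ez
    exact r (hun' z₂ h₂.wz ez ▸ hw.reach_w hx)

lemma zeq3 (h : Crit G k) {v : V} {c : V → Fin k} (hc : Tok G v c) {x y y' y'' w z w' z' w'' z'' : V}
    (hx : Sg G v c x) (hy : Sg G v c y) (hy' : Sg G v c y') (hy'' : Sg G v c y'')
    (hxy : x ≠ y) (hxy' : x ≠ y') (hxy'' : x ≠ y'')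
    (n1 : y ≠ y') (n2 : y ≠ y'') (n3 : y' ≠ y'')
    (hadj : ¬ G.Adj x y) (hadj' : ¬ G.Adj x y') (hadj'' : ¬ G.Adj x y'')
    (hw : WZ G v c x y w z) (hw' : WZ G v c x y' w' z') (hw'' : WZ G v c x y'' w'' z'') :
    z'' = z ∨ z'' = z' := by
  rcases zeq h hc hx hy hy'' hxy hxy'' n2 hadj hadj'' hw hw'' with e | ⟨a, b, hab, ha, hb, ca, cb⟩
  · exact Or.inl e
  rcases zeq h hc hx hy' hy'' hxy' hxy'' n3 hadj' hadj'' hw' hw'' with e | ⟨a', b', hab', ha', hb', ca', cb'⟩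
  · exact Or.inr e
  exfalso
  have key : ∀ u, G.Adj w'' u → u ≠ v := by
    rintro u hu rfl
    exact hw''.vw hu.symm
  have key2 : ∀ u y₀, Sg G v c y₀ → x ≠ y₀ → c u = c y₀ → u ≠ x := by
    rintro u y₀ q1 q2 q3 rfl
    exact q1.ne_col hx q2 q3
  refine F4 h (F3 hc hx) (sgSlide hx hy'' hxy'' hw'') ha hb ha' hb' (key2 a y hy hxy ca)
    (key2 b y hy hxy cb) (key2 a' y' hy' hxy' ca') (key2 b' y' hy' hxy' cb') hab hab' ?_ ?_ ?_
  · rw [Function.update_of_ne (key a ha), Function.update_of_ne (key b hb), ca, cb]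
  · rw [Function.update_of_ne (key a' ha'), Function.update_of_ne (key b' hb'), ca', cb']
  · rw [Function.update_of_ne (key a ha), Function.update_of_ne (key a' ha'), ca, ca']
    exact hy'.ne_col hy n1

/-- no single vertex has three nonadjacent singles -/
lemma no_three (h : Crit G k) {v : V} {c : V → Fin k} (hc : Tok G v c) {x y y' y'' : V}
    (hx : Sg G v c x) (hy : Sg G v c y) (hy' : Sg G v c y') (hy'' : Sg G v c y'')
    (hxy : x ≠ y) (hxy' : x ≠ y') (hxy'' : x ≠ y'')
    (n1 : y ≠ y') (n2 : y ≠ y'') (n3 : y' ≠ y'')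
    (hadj : ¬ G.Adj x y) (hadj' : ¬ G.Adj x y') (hadj'' : ¬ G.Adj x y'') : False := by
  obtain ⟨w, z, hw⟩ := exWZ h hc hx hy hxy hadj
  obtain ⟨w', z', hw'⟩ := exWZ h hc hx hy' hxy' hadj'
  obtain ⟨w'', z'', hw''⟩ := exWZ h hc hx hy'' hxy'' hadj''
  have e1 := zeq3 h hc hx hy hy' hy'' hxy hxy' hxy'' n1 n2 n3 hadj hadj' hadj'' hw hw' hw''
  have e2 := zeq3 h hc hx hy hy'' hy' hxy hxy'' hxy' n2 n1 n3.symm hadj hadj'' hadj' hw hw'' hw'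
  have e3 := zeq3 h hc hx hy' hy'' hy hxy' hxy'' hxy n3 n1.symm n2.symm hadj' hadj'' hadj hw' hw'' hw
  have ez' : z' = z := by grind
  have ez'' : z'' = z := by grind
  subst ez' ez''
  obtain ⟨a, b, ab, ha, hb, ca, cb, -, -⟩ := two_nb h hc hx hy hxy hadj (hw.reach_z hx) hw.cz hw.zx
  obtain ⟨a', b', ab', ha', hb', ca', cb', -, -⟩ :=
    two_nb h hc hx hy' hxy' hadj' (hw'.reach_z hx) hw.cz hw.zx
  obtain ⟨a'', b'', ab'', ha'', hb'', ca'', cb'', -, -⟩ :=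
    two_nb h hc hx hy'' hxy'' hadj'' (hw''.reach_z hx) hw.cz hw.zx
  have c1 := hy'.ne_col hy n1
  have c2 := hy''.ne_col hy n2
  have c3 := hy''.ne_col hy' n3
  have hsub : (nb G z'').image c ⊆ ((((nb G z'').erase b).erase b').erase b'').image c := by
    intro m hm
    obtain ⟨u, hu, rfl⟩ := mem_image.1 hm
    by_cases q1 : u = b
    · subst q1
      exact mem_image.2 ⟨a, by simp only [mem_erase, mem_nb]; grind, by rw [ca, cb]⟩
    by_cases q2 : u = b'
    · subst q2
      exact mem_image.2 ⟨a', by simp only [mem_erase, mem_nb]; grind, by rw [ca', cb']⟩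
    by_cases q3 : u = b''
    · subst q3
      exact mem_image.2 ⟨a'', by simp only [mem_erase, mem_nb]; grind, by rw [ca'', cb'']⟩
    exact mem_image.2 ⟨u, by simp only [mem_erase]; exact ⟨q3, q2, q1, hu⟩, rfl⟩
  have hcard := (card_le_card hsub).trans card_image_le
  rw [card_erase_of_mem (by simp only [mem_erase, mem_nb]; grind),
    card_erase_of_mem (by simp only [mem_erase, mem_nb]; grind),
    card_erase_of_mem (by simp only [mem_nb]; grind)] at hcard
  have hdeg := h.deg z''
  have hk := h.hk
  have hlt : (insert (c x) ((nb G z'').image c)).card < (Finset.univ : Finset (Fin k)).card := by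
    have := card_insert_le (c x) ((nb G z'').image c)
    simp only [card_univ, Fintype.card_fin]
    omega
  obtain ⟨m, -, hm⟩ := Finset.exists_mem_notMem_of_card_lt_card hlt
  rw [mem_insert, not_or] at hm
  have hmz : ∀ u, G.Adj z'' u → c u ≠ m := fun u hu e => hm.2 (mem_image.2 ⟨u, mem_nb.2 hu, e⟩)
  have nz : ∀ u, G.Adj v u → u ≠ z'' := by rintro u hu rfl; exact hw.vz hu
  have tok : Tok G v (Function.update c z'' m) := by
    intro p q hp hq hpq
    by_cases e1 : p = z''
    · subst e1
      rw [Function.update_self, Function.update_of_ne hpq.ne']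
      exact (hmz q hpq).symm
    · by_cases e2 : q = z''
      · subst e2
        rw [Function.update_self, Function.update_of_ne e1]
        exact hmz p hpq.symm
      · rw [Function.update_of_ne e1, Function.update_of_ne e2]
        exact hc p q hp hq hpq
  have sg : ∀ u, Sg G v c u → Sg G v (Function.update c z'' m) u := by
    intro u hu
    refine ⟨hu.1, fun p hp e => ?_⟩
    rw [Function.update_of_ne (nz p hp), Function.update_of_ne (nz u hu.1)] at e
    exact hu.2 p hp e
  obtain ⟨w₂, z₂, h₂⟩ := exWZ h tok (sg x hx) (sg y hy) hxy hadj
  have t1 := h₂.cw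
  have t2 := h₂.cz
  rw [Function.update_of_ne (nz y hy.1)] at t1
  rw [Function.update_of_ne (nz x hx.1)] at t2
  have hw2z : w₂ ≠ z'' := by
    rintro rfl
    exact hc x w₂ hx.1.ne' h₂.wv h₂.xw hw.cz.symm
  rw [Function.update_of_ne hw2z] at t1
  have e4 : w₂ = w := hw.wu w₂ h₂.xw h₂.wv t1
  subst e4
  by_cases e5 : z₂ = z''
  · subst e5
    rw [Function.update_self] at t2
    exact hm.1 t2
  · rw [Function.update_of_ne e5] at t2
    exact e5 (hw.zu z₂ h₂.wz h₂.zx t2)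

/-- set of singles -/
noncomputable def sg (G : SimpleGraph V) (v : V) (c : V → Fin k) : Finset V :=
  Finset.univ.filter (fun x => Sg G v c x)

lemma mem_sg {v : V} {c : V → Fin k} {x : V} : x ∈ sg G v c ↔ Sg G v c x := by simp [sg]

lemma structure_N (h : Crit G k) {v : V} {c : V → Fin k} (hc : Tok G v c) :
    ((nb G v).card = k ∧ nb G v = sg G v c) ∨
    ((nb G v).card = k + 1 ∧ (sg G v c).card + 1 = k ∧ ∃ y y', y ≠ y' ∧ G.Adj v y ∧ G.Adj v y' ∧
      c y = c y' ∧ nb G v = insert y (insert y' (sg G v c)) ∧ y ∉ sg G v c ∧ y' ∉ sg G v c) := by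
  have hsub : sg G v c ⊆ nb G v := fun u hu => mem_nb.2 (mem_sg.1 hu).1
  by_cases hinj : ∀ a ∈ nb G v, ∀ b ∈ nb G v, c a = c b → a = b
  · left
    refine ⟨?_, ?_⟩
    · have : (nb G v).image c = Finset.univ := by
        ext j; simp only [mem_univ, iff_true]
        obtain ⟨x, hx, e⟩ := F1 h hc j
        exact mem_image.2 ⟨x, mem_nb.2 hx, e⟩
      have e2 := card_image_of_injOn (s := nb G v) (f := c) (fun a ha b hb e => hinj a ha b hb e)
      rw [this, card_univ, Fintype.card_fin] at e2
      exact e2.symm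
    · refine (Finset.Subset.antisymm hsub ?_).symm
      intro u hu
      exact mem_sg.2 ⟨mem_nb.1 hu, fun p hp e => hinj p (mem_nb.2 hp) u hu e⟩
  · right
    push Not at hinj
    obtain ⟨y, hy, y', hy', e, hne⟩ := hinj
    have him : ((nb G v).erase y').image c = Finset.univ := by
      ext j; simp only [mem_univ, iff_true]
      obtain ⟨x, hx, ex⟩ := F1 h hc j
      by_cases q : x = y'
      · subst q
        exact mem_image.2 ⟨y, by simp [hne, hy], e.trans ex⟩
      · exact mem_image.2 ⟨x, by simp [q, mem_nb, hx], ex⟩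
    have hc1 := card_image_le (s := (nb G v).erase y') (f := c)
    have hc2 := card_erase_of_mem hy'
    have hc3 := card_pos.2 ⟨y', hy'⟩
    rw [him, card_univ, Fintype.card_fin] at hc1
    have hd := h.deg v
    have hinj : Set.InjOn c ((nb G v).erase y') := by
      rw [← card_image_iff, him, card_univ, Fintype.card_fin]; omega
    have hsg : ∀ u ∈ nb G v, u ≠ y → u ≠ y' → Sg G v c u := by
      intro u hu h1 h2
      refine ⟨mem_nb.1 hu, fun p hp ep => ?_⟩
      by_cases q : p = y'
      · subst q
        exact absurd (hinj (by simp [hu, h2]) (by simp [hy, hne]) (ep.symm.trans e.symm)) h1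
      · exact hinj (by simp [q, mem_nb, hp]) (by simpa [h2] using hu) ep
    have n1 : y ∉ sg G v c := fun q => hne ((mem_sg.1 q).2 y' (mem_nb.1 hy') e.symm).symm
    have n2 : y' ∉ sg G v c := fun q => hne ((mem_sg.1 q).2 y (mem_nb.1 hy) e)
    have hN : nb G v = insert y (insert y' (sg G v c)) := by
      ext u
      simp only [mem_insert]
      constructor
      · intro hu
        by_cases q1 : u = y
        · exact Or.inl q1
        by_cases q2 : u = y'
        · exact Or.inr (Or.inl q2)
        exact Or.inr (Or.inr (mem_sg.2 (hsg u hu q1 q2)))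
      · rintro (rfl | rfl | hu)
        · exact hy
        · exact hy'
        · exact hsub hu
    have hcN := congrArg Finset.card hN
    rw [card_insert_of_notMem (by simp [hne, n1]), card_insert_of_notMem n2] at hcN
    exact ⟨by omega, by omega, y, y', hne, mem_nb.1 hy, mem_nb.1 hy', e, hN, n1, n2⟩

lemma nonnb_le (h : Crit G k) {v : V} {c : V → Fin k} (hc : Tok G v c) {x : V} (hx : Sg G v c x) :
    ((sg G v c).filter (fun y => y ≠ x ∧ ¬ G.Adj x y)).card ≤ 2 := by
  by_contra hcon
  push Not at hcon
  rw [Finset.two_lt_card] at hcon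
  obtain ⟨a, ha, b, hb, d, hd, n1, n2, n3⟩ := hcon
  simp only [mem_filter, mem_sg] at ha hb hd
  exact no_three h hc hx ha.1 hb.1 hd.1 ha.2.1.symm hb.2.1.symm hd.2.1.symm n1 n2 n3 ha.2.2 hb.2.2 hd.2.2

lemma forb_le (h : Crit G k) {v : V} {c : V → Fin k} (hc : Tok G v c) {x : V} (hx : Sg G v c x) :
    (nb G x \ insert v (sg G v c)).card + (sg G v c).card ≤ k + 3 := by
  have h1 := nonnb_le h hc hx
  have h2 : sg G v c ⊆ insert x ((nb G x ∩ sg G v c) ∪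
      (sg G v c).filter (fun y => y ≠ x ∧ ¬ G.Adj x y)) := by
    intro u hu
    simp only [mem_insert, mem_union, mem_inter, mem_filter, mem_nb]
    tauto
  have h3 := card_le_card h2
  have h4 := card_insert_le x ((nb G x ∩ sg G v c) ∪
      (sg G v c).filter (fun y => y ≠ x ∧ ¬ G.Adj x y))
  have h5 := card_union_le (nb G x ∩ sg G v c) ((sg G v c).filter (fun y => y ≠ x ∧ ¬ G.Adj x y))
  have hv : v ∉ sg G v c := fun q => G.loopless.irrefl v (mem_sg.1 q).1
  have h6 : (insert v (nb G x ∩ sg G v c)).card = (nb G x ∩ sg G v c).card + 1 :=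
    card_insert_of_notMem (by simp [hv])
  have h7 : nb G x ∩ insert v (sg G v c) = insert v (nb G x ∩ sg G v c) :=
    inter_insert_of_mem (mem_nb.2 hx.1.symm)
  have h8 := card_sdiff_add_card_inter (nb G x) (insert v (sg G v c))
  rw [h7, h6] at h8
  have := h.deg x
  omega

set_option maxHeartbeats 1000000 in
/-- the singles are pairwise adjacent -/
lemma sg_clique (h : Crit G k) {v : V} {c : V → Fin k} (hc : Tok G v c) {x₁ x₂ : V}
    (h₁ : Sg G v c x₁) (h₂ : Sg G v c x₂) (hne : x₁ ≠ x₂) : G.Adj x₁ x₂ := by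
  by_contra hadj
  have hk := h.hk
  set S := sg G v c with hS
  have hv : v ∉ S := fun q => G.loopless.irrefl v (mem_sg.1 q).1
  have f1 := forb_le h hc h₁
  have f2 := forb_le h hc h₂
  have hst := structure_N h hc
  rw [← hS] at f1 f2 hst
  have hScard : k ≤ S.card + 1 := by
    rcases hst with ⟨q1, q2⟩ | ⟨q1, q2, -⟩
    · rw [← q2]; omega
    · omega
  -- common color
  have hcc : (((nb G x₁ \ insert v S).image c) ∪ ((nb G x₂ \ insert v S).image c)).card
      < (Finset.univ : Finset (Fin k)).card := by
    rw [card_univ, Fintype.card_fin]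
    have i1 := card_image_le (s := nb G x₁ \ insert v S) (f := c)
    have i2 := card_image_le (s := nb G x₂ \ insert v S) (f := c)
    rcases hst with ⟨q1, q2⟩ | ⟨q1, q2, y, y', hyy, hy, hy', e, hN, n1, n2⟩
    · have := card_union_le ((nb G x₁ \ insert v S).image c) ((nb G x₂ \ insert v S).image c)
      rw [q2] at q1
      omega
    · have hyv : y ≠ v := hy.ne'
      have hyv' : y' ≠ v := hy'.ne'
      have key : ∀ x, Sg G v c x → c y ∈ (nb G x \ insert v S).image c := by
        intro x hx
        have nx : x ≠ y := by rintro rfl; exact n1 (mem_sg.2 hx)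
        have nx' : x ≠ y' := by rintro rfl; exact n2 (mem_sg.2 hx)
        by_cases a1 : G.Adj x y
        · exact mem_image.2 ⟨y, by simp [mem_nb, a1, n1, hyv], rfl⟩
        by_cases a2 : G.Adj x y'
        · exact mem_image.2 ⟨y', by simp [mem_nb, a2, n2, hyv'], e.symm⟩
        exact absurd e (hc y y' hyv hyv' (h.claw v x y y' hx.1 hy hy' nx nx' hyy a1 a2))
      have i3 := card_union_add_card_inter ((nb G x₁ \ insert v S).image c) ((nb G x₂ \ insert v S).image c)
      have i4 : 0 < (((nb G x₁ \ insert v S).image c) ∩ ((nb G x₂ \ insert v S).image c)).card :=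
        card_pos.2 ⟨c y, mem_inter.2 ⟨key _ h₁, key _ h₂⟩⟩
      omega
  obtain ⟨c₀, -, hc₀⟩ := Finset.exists_mem_notMem_of_card_lt_card hcc
  rw [mem_union, not_or] at hc₀
  have hf1 : ∀ u, u ∉ S → u ≠ v → G.Adj x₁ u → c u ≠ c₀ := fun u a b d e =>
    hc₀.1 (mem_image.2 ⟨u, by simp [mem_nb, a, b, d], e⟩)
  have hf2 : ∀ u, u ∉ S → u ≠ v → G.Adj x₂ u → c u ≠ c₀ := fun u a b d e =>
    hc₀.2 (mem_image.2 ⟨u, by simp [mem_nb, a, b, d], e⟩)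
  have m1 : x₁ ∈ S := mem_sg.2 h₁
  have m2 : x₂ ∈ S := mem_sg.2 h₂
  have hx1v : x₁ ≠ v := h₁.1.ne'
  have hx2v : x₂ ≠ v := h₂.1.ne'
  let c₁ : V → Fin k := fun u => if u = x₁ ∨ u = x₂ then c₀ else c u
  have c1a : c₁ x₁ = c₀ := by simp [c₁]
  have c1b : c₁ x₂ = c₀ := by simp [c₁]
  have c1c : ∀ u, u ∉ S → c₁ u = c u := by
    intro u hu
    have a1 : u ≠ x₁ := by rintro rfl; exact hu m1
    have a2 : u ≠ x₂ := by rintro rfl; exact hu m2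
    simp [c₁, a1, a2]
  let A₁ : Finset V := Finset.univ.filter (fun u => u = x₁ ∨ u = x₂ ∨ (u ∉ S ∧ u ≠ v))
  let B : Finset V := S.filter (fun u => u ≠ x₁ ∧ u ≠ x₂ ∧ ¬ (G.Adj x₁ u ∧ G.Adj x₂ u))
  let D : Finset V := S.filter (fun u => G.Adj x₁ u ∧ G.Adj x₂ u)
  have mA : ∀ u, u ∈ A₁ ↔ u = x₁ ∨ u = x₂ ∨ (u ∉ S ∧ u ≠ v) := by simp [A₁]
  have mB : ∀ u, u ∈ B ↔ u ∈ S ∧ u ≠ x₁ ∧ u ≠ x₂ ∧ ¬ (G.Adj x₁ u ∧ G.Adj x₂ u) := by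
    intro u; simp only [B, mem_filter]
  have mD : ∀ u, u ∈ D ↔ u ∈ S ∧ G.Adj x₁ u ∧ G.Adj x₂ u := by
    intro u; simp only [D, mem_filter]
  have p1 : PC G A₁ c₁ := by
    intro a ha b hb hab
    rw [mA] at ha hb
    rcases ha with rfl | rfl | ha <;> rcases hb with rfl | rfl | hb
    · exact absurd hab (G.loopless.irrefl _)
    · exact absurd hab hadj
    · rw [c1a, c1c b hb.1]; exact (hf1 b hb.1 hb.2 hab).symm
    · exact absurd hab.symm hadj
    · exact absurd hab (G.loopless.irrefl _)
    · rw [c1b, c1c b hb.1]; exact (hf2 b hb.1 hb.2 hab).symm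
    · rw [c1a, c1c a ha.1]; exact (hf1 a ha.1 ha.2 hab.symm)
    · rw [c1b, c1c a ha.1]; exact (hf2 a ha.1 ha.2 hab.symm)
    · rw [c1c a ha.1, c1c b hb.1]; exact hc a b ha.2 hb.2 hab
  -- few bad vertices
  have hbad : B.card ≤ 2 := by
    have t1 := nonnb_le h hc h₁
    have t2 := nonnb_le h hc h₂
    rw [← hS] at t1 t2
    have u1 : x₂ ∈ S.filter (fun y => y ≠ x₁ ∧ ¬ G.Adj x₁ y) := by simp [m2, hne.symm, hadj]
    have u2 : x₁ ∈ S.filter (fun y => y ≠ x₂ ∧ ¬ G.Adj x₂ y) := by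
      simp only [mem_filter]
      exact ⟨m1, hne, fun q => hadj q.symm⟩
    have hB : B ⊆ ((S.filter (fun y => y ≠ x₁ ∧ ¬ G.Adj x₁ y)).erase x₂) ∪
        ((S.filter (fun y => y ≠ x₂ ∧ ¬ G.Adj x₂ y)).erase x₁) := by
      intro u hu
      rw [mB] at hu
      simp only [mem_union, mem_erase, mem_filter]
      tauto
    have t3 := (card_le_card hB).trans (card_union_le _ _)
    rw [card_erase_of_mem u1, card_erase_of_mem u2] at t3
    omega
  have hD3 : 3 ≤ D.card := by
    have : S ⊆ insert x₁ (insert x₂ (B ∪ D)) := by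
      intro u hu
      simp only [mem_insert, mem_union, mB, mD]
      tauto
    have t1 := card_le_card this
    have t2 := card_insert_le x₁ (insert x₂ (B ∪ D))
    have t3 := card_insert_le x₂ (B ∪ D)
    have t4 := card_union_le B D
    omega
  obtain ⟨c₂, p2, e2⟩ := ext_save A₁ B c₁ (by
      rw [Finset.disjoint_left]
      intro a ha hb
      rw [mA] at ha; rw [mB] at hb; tauto) p1 (by
    intro u hu
    rw [mB] at hu
    have hg : ∃ g ∈ D, G.Adj u g := by
      by_contra hcon
      push Not at hcon
      have hsub : D ⊆ S.filter (fun y => y ≠ u ∧ ¬ G.Adj u y) := by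
        intro g hg
        have := (mD g).1 hg
        simp only [mem_filter]
        refine ⟨this.1, ?_, hcon g hg⟩
        rintro rfl
        exact hu.2.2.2 this.2
      have t1 := card_le_card hsub
      have t2 := nonnb_le h hc (mem_sg.1 hu.1)
      rw [← hS] at t2
      omega
    obtain ⟨g, hg, hug⟩ := hg
    have hgD := (mD g).1 hg
    have hgv : g ≠ v := by rintro rfl; exact hv hgD.1
    have huv : G.Adj u v := (mem_sg.1 hu.1).1.symm
    refine ⟨{v, g}, ?_, ?_, ?_⟩
    · intro q hq
      simp only [mem_insert, mem_singleton] at hq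
      rcases hq with rfl | rfl
      · exact mem_nb.2 huv
      · exact mem_nb.2 hug
    · rw [card_pair hgv.symm]
      have := h.deg u
      omega
    · intro q hq
      simp only [mem_insert, mem_singleton] at hq
      rcases hq with rfl | rfl
      · refine ⟨fun q => hv ((mB _).1 q).1, fun q => ?_⟩
        rw [mA] at q
        rcases q with q | q | q
        · exact absurd q.symm hx1v
        · exact absurd q.symm hx2v
        · exact absurd rfl q.2
      · refine ⟨fun q' => ((mB _).1 q').2.2.2 hgD.2, fun q' => ?_⟩
        rw [mA] at q'
        rcases q' with q' | q' | q'
        · exact absurd q'.symm hgD.2.1.ne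
        · exact absurd q'.symm hgD.2.2.ne
        · exact absurd hgD.1 q'.1)
  have x1A : x₁ ∈ A₁ := (mA _).2 (Or.inl rfl)
  have x2A : x₂ ∈ A₁ := (mA _).2 (Or.inr (Or.inl rfl))
  obtain ⟨c₃, p3, e3⟩ := ext_save (A₁ ∪ B) D c₂ (by
      rw [Finset.disjoint_left]
      intro a ha hb
      rw [mem_union, mA, mB] at ha; rw [mD] at hb
      have := hb.2.1.ne
      have := hb.2.2.ne
      grind) p2 (by
    intro u hu
    rw [mD] at hu
    have huv : G.Adj u v := (mem_sg.1 hu.1).1.symm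
    refine ⟨{v, x₂}, ?_, ?_, ?_⟩
    · intro q hq
      simp only [mem_insert, mem_singleton] at hq
      rcases hq with rfl | rfl
      · exact mem_nb.2 huv
      · exact mem_nb.2 hu.2.2.symm
    · rw [card_pair hx2v.symm]
      have := h.deg u
      omega
    · intro q hq
      simp only [mem_insert, mem_singleton] at hq
      rcases hq with rfl | rfl
      · refine ⟨fun q => hv ((mD _).1 q).1, fun q => ?_⟩
        rw [mem_union, mA, mB] at q
        exfalso
        rcases q with (q | q | q) | q
        · exact absurd q.symm hx1v
        · exact absurd q.symm hx2v
        · exact absurd rfl q.2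
        · exact hv q.1
      · refine ⟨fun q' => G.loopless.irrefl _ ((mD _).1 q').2.2, fun _ => ?_⟩
        refine ⟨x₁, mem_union_left _ x1A, hu.2.1.symm, by simp [hx1v, hne], ?_⟩
        rw [e2 _ x1A, e2 _ x2A, c1a, c1b])
  have e3' : ∀ u ∈ A₁, c₃ u = c₁ u := fun u hu => by rw [e3 u (mem_union_left _ hu), e2 u hu]
  have hvA : v ∉ A₁ ∪ B ∪ D := by
    rw [mem_union, mem_union, mA, mB, mD]
    rintro (((q | q | q) | q) | q)
    · exact hx1v q.symm
    · exact hx2v q.symm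
    · exact q.2 rfl
    · exact hv q.1
    · exact hv q.1
  have hall : ∀ u, u ≠ v → u ∈ A₁ ∪ B ∪ D := by
    intro u hu
    rw [mem_union, mem_union, mA, mB, mD]
    tauto
  obtain ⟨c₄, p4, -⟩ := ext_save (A₁ ∪ B ∪ D) {v} c₃ (by
      rw [Finset.disjoint_singleton_right]; exact hvA) p3 (by
    intro u hu
    rw [mem_singleton] at hu
    subst hu
    have e12 : c₃ x₁ = c₃ x₂ := by rw [e3' _ x1A, e3' _ x2A, c1a, c1b]
    rcases hst with ⟨q1, q2⟩ | ⟨q1, q2, y, y', hyy, hy, hy', e, hN, n1, n2⟩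
    · refine ⟨{x₂}, ?_, ?_, ?_⟩
      · intro q hq
        rw [mem_singleton] at hq
        subst hq
        exact mem_nb.2 h₂.1
      · rw [card_singleton]; omega
      · intro q hq
        rw [mem_singleton] at hq
        subst hq
        exact ⟨by simpa using hx2v, fun _ => ⟨x₁, hall _ hx1v, h₁.1, by simpa using hne, e12⟩⟩
    · have ny : x₂ ≠ y' := by rintro rfl; exact n2 m2
      have ny1 : x₁ ≠ y' := by rintro rfl; exact n2 m1
      have ny2 : y ≠ x₂ := by rintro rfl; exact n1 m2
      have yA : y ∈ A₁ := (mA _).2 (Or.inr (Or.inr ⟨n1, hy.ne'⟩))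
      have yA' : y' ∈ A₁ := (mA _).2 (Or.inr (Or.inr ⟨n2, hy'.ne'⟩))
      refine ⟨{x₂, y'}, ?_, ?_, ?_⟩
      · intro q hq
        simp only [mem_insert, mem_singleton] at hq
        rcases hq with rfl | rfl
        · exact mem_nb.2 h₂.1
        · exact mem_nb.2 hy'
      · rw [card_pair ny]; omega
      · intro q hq
        simp only [mem_insert, mem_singleton] at hq
        rcases hq with rfl | rfl
        · exact ⟨by simpa using hx2v, fun _ => ⟨x₁, hall _ hx1v, h₁.1, by simp [hne, ny1], e12⟩⟩
        · refine ⟨by simpa using hy'.ne', fun _ => ⟨y, hall _ hy.ne', hy, by simp [hyy, ny2], ?_⟩⟩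
          rw [e3' _ yA, e3' _ yA', c1c _ n1, c1c _ n2, e])
  apply h.nocol c₄
  have : A₁ ∪ B ∪ D ∪ {v} = Finset.univ := by
    ext u
    simp only [mem_univ, iff_true, mem_union (s := A₁ ∪ B ∪ D), mem_singleton]
    by_cases q : u = v
    · exact Or.inr q
    · exact Or.inl (hall u q)
  rwa [this] at p4

/-- the local structure at every vertex -/
lemma star (h : Crit G k) (v : V) : (nb G v).card = k + 1 ∧ ∃ (S : Finset V) (y y' : V),
    S.card + 1 = k ∧ y ≠ y' ∧ ¬ G.Adj y y' ∧ nb G v = insert y (insert y' S) ∧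
    (∀ a ∈ S, ∀ b ∈ S, a ≠ b → G.Adj a b) := by
  obtain ⟨c, hc⟩ := h.crit v
  have hcl : ∀ a ∈ sg G v c, ∀ b ∈ sg G v c, a ≠ b → G.Adj a b := fun a ha b hb hne =>
    sg_clique h hc (mem_sg.1 ha) (mem_sg.1 hb) hne
  rcases structure_N h hc with ⟨q1, q2⟩ | ⟨q1, q2, y, y', hyy, hy, hy', e, hN, n1, n2⟩
  · exfalso
    have := h.noclq (insert v (nb G v)) (by
      intro a ha b hb hab
      rcases mem_insert.1 ha with e1 | ha' <;> rcases mem_insert.1 hb with e2 | hb'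
      · exact absurd (e1.trans e2.symm) hab
      · rw [e1]; exact mem_nb.1 hb'
      · rw [e2]; exact (mem_nb.1 ha').symm
      · rw [q2] at ha' hb'; exact hcl a ha' b hb' hab)
    rw [card_insert_of_notMem (by simp [mem_nb]), q1] at this
    omega
  · exact ⟨q1, sg G v c, y, y', q2, hyy, fun q => hc y y' hy.ne' hy'.ne' q e, hN, hcl⟩

lemma any_part (h : Crit G k) {D : Finset V} {d : V} (hd : d ∈ D) :
    ∃ c : V → Fin k, PC G (Finset.univ \ D) c := by
  obtain ⟨c, hc⟩ := h.crit d
  refine ⟨c, fun a ha b hb hab => hc a b ?_ ?_ hab⟩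
  · rintro rfl; simp [hd] at ha
  · rintro rfl; simp [hd] at hb

/-- A clique `T` of size `k-1` with two nonadjacent vertices complete to it. -/
structure TPW (G : SimpleGraph V) (k : ℕ) (T : Finset V) (p w : V) (f : V → V) : Prop where
  card : T.card + 1 = k
  cl : ∀ a ∈ T, ∀ b ∈ T, a ≠ b → G.Adj a b
  pT : p ∉ T
  wT : w ∉ T
  pw : p ≠ w
  npw : ¬ G.Adj p w
  pa : ∀ t ∈ T, G.Adj p t
  wa : ∀ t ∈ T, G.Adj w t
  fa : ∀ t ∈ T, G.Adj t (f t)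
  fT : ∀ t ∈ T, f t ∉ T
  fp : ∀ t ∈ T, f t ≠ p
  fw : ∀ t ∈ T, f t ≠ w
  fu : ∀ t ∈ T, ∀ u, G.Adj t u → u ∈ T ∨ u = p ∨ u = w ∨ u = f t

lemma out_card (h : Crit G k) {T : Finset V} (hT : T.card + 1 = k) {p : V}
    (pa : ∀ t ∈ T, G.Adj p t) : (nb G p \ T).card ≤ 2 := by
  have h1 : T ⊆ nb G p := fun t ht => mem_nb.2 (pa t ht)
  rw [card_sdiff_of_subset h1]
  have := h.deg p
  omega

lemma tpw_col (h : Crit G k) {T : Finset V} {p w : V} {f : V → V} (H : TPW G k T p w f)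
    {c : V → Fin k} (hc : PC G (Finset.univ \ insert p (insert w T)) c) {t₁ t₂ : V}
    (h₁ : t₁ ∈ T) (h₂ : t₂ ∈ T) (hne : c (f t₁) ≠ c (f t₂)) : False := by
  have hk := h.hk
  have hlt : ((nb G p \ T ∪ nb G w \ T).image c).card < (Finset.univ : Finset (Fin k)).card := by
    rw [card_univ, Fintype.card_fin]
    have a1 := out_card h H.card H.pa
    have a2 := out_card h H.card H.wa
    have a3 := card_union_le (nb G p \ T) (nb G w \ T)
    have a4 := card_image_le (s := nb G p \ T ∪ nb G w \ T) (f := c)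
    omega
  obtain ⟨c₀, -, hc₀⟩ := Finset.exists_mem_notMem_of_card_lt_card hlt
  have hp0 : ∀ u, u ∉ T → G.Adj p u → c u ≠ c₀ := fun u a b e =>
    hc₀ (mem_image.2 ⟨u, by simp [mem_nb, a, b], e⟩)
  have hw0 : ∀ u, u ∉ T → G.Adj w u → c u ≠ c₀ := fun u a b e =>
    hc₀ (mem_image.2 ⟨u, by simp [mem_nb, a, b], e⟩)
  clear hc₀ hlt
  wlog hm : c (f t₁) ≠ c₀ generalizing t₁ t₂ with Hw
  · push Not at hm
    exact Hw h₂ h₁ hne.symm (fun e => hne (hm.trans e.symm))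
  have h12 : t₁ ≠ t₂ := by rintro rfl; exact hne rfl
  have nA : ∀ u, u ∉ T → u ≠ p → u ≠ w → u ∈ Finset.univ \ insert p (insert w T) := by
    intro u a b d; simp [a, b, d]
  let c₁ : V → Fin k := fun u => if u = p ∨ u = w then c₀ else if u = t₂ then c (f t₁) else c u
  have t2p : t₂ ≠ p := by rintro rfl; exact H.pT h₂
  have t2w : t₂ ≠ w := by rintro rfl; exact H.wT h₂
  have t1p : t₁ ≠ p := by rintro rfl; exact H.pT h₁
  have t1w : t₁ ≠ w := by rintro rfl; exact H.wT h₁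
  have cp : c₁ p = c₀ := by simp [c₁]
  have cw : c₁ w = c₀ := by simp [c₁]
  have ct : c₁ t₂ = c (f t₁) := by simp [c₁, t2p, t2w]
  have co : ∀ u, u ∉ T → u ≠ p → u ≠ w → c₁ u = c u := by
    intro u a b d
    have : u ≠ t₂ := by rintro rfl; exact a h₂
    simp [c₁, b, d, this]
  let A : Finset V := Finset.univ.filter (fun u => u ∉ T ∨ u = t₂)
  have mA : ∀ u, u ∈ A ↔ u ∉ T ∨ u = t₂ := by simp [A]
  have pA : p ∈ A := (mA _).2 (Or.inl H.pT)
  have wA : w ∈ A := (mA _).2 (Or.inl H.wT)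
  have fA : f t₁ ∈ A := (mA _).2 (Or.inl (H.fT _ h₁))
  have tA : t₂ ∈ A := (mA _).2 (Or.inr rfl)
  -- one-sided checks
  have k1 : ∀ u, u ∈ A → G.Adj p u → c₁ u ≠ c₀ := by
    intro u hu hpu
    rcases (mA _).1 hu with q | rfl
    · have n2 : u ≠ w := by rintro rfl; exact H.npw hpu
      rw [co u q hpu.ne' n2]; exact hp0 u q hpu
    · rw [ct]; exact hm
  have k2 : ∀ u, u ∈ A → G.Adj w u → c₁ u ≠ c₀ := by
    intro u hu hpu
    rcases (mA _).1 hu with q | rfl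
    · have n2 : u ≠ p := by rintro rfl; exact H.npw hpu.symm
      rw [co u q n2 hpu.ne']; exact hw0 u q hpu
    · rw [ct]; exact hm
  have k3 : ∀ u, u ∉ T → u ≠ p → u ≠ w → G.Adj t₂ u → c u ≠ c (f t₁) := by
    intro u a b d e
    rcases H.fu t₂ h₂ u e with q | q | q | q
    · exact absurd q a
    · exact absurd q b
    · exact absurd q d
    · rw [q]; exact hne.symm
  have p1 : PC G A c₁ := by
    intro a ha b hb hab
    by_cases a1 : a = p
    · rw [a1, cp]; exact (k1 b hb (a1 ▸ hab)).symm
    by_cases a2 : a = w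
    · rw [a2, cw]; exact (k2 b hb (a2 ▸ hab)).symm
    by_cases b1 : b = p
    · rw [b1, cp]; exact (k1 a ha (b1 ▸ hab.symm))
    by_cases b2 : b = w
    · rw [b2, cw]; exact (k2 a ha (b2 ▸ hab.symm))
    rcases (mA _).1 ha with qa | qa <;> rcases (mA _).1 hb with qb | qb
    · rw [co a qa a1 a2, co b qb b1 b2]
      exact hc a (nA a qa a1 a2) b (nA b qb b1 b2) hab
    · rw [qb, ct, co a qa a1 a2]; exact k3 a qa a1 a2 (qb ▸ hab.symm)
    · rw [qa, ct, co b qb b1 b2]; exact (k3 b qb b1 b2 (qa ▸ hab)).symm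
    · exact absurd (qa.trans qb.symm) hab.ne
  let R : Finset V := (T.erase t₂).erase t₁
  have mR : ∀ u, u ∈ R ↔ u ≠ t₁ ∧ u ≠ t₂ ∧ u ∈ T := by simp [R]
  obtain ⟨c₂, p2, e2⟩ := ext_save A R c₁ (by
      rw [Finset.disjoint_left]
      intro a ha hb
      rw [mA] at ha; rw [mR] at hb; tauto) p1 (by
    intro u hu
    rw [mR] at hu
    refine ⟨{t₁, w}, ?_, ?_, ?_⟩
    · intro q hq
      simp only [mem_insert, mem_singleton] at hq
      rcases hq with rfl | rfl
      · exact mem_nb.2 (H.cl _ hu.2.2 _ h₁ hu.1)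
      · exact mem_nb.2 (H.wa _ hu.2.2).symm
    · rw [card_pair t1w]
      have := h.deg u
      omega
    · intro q hq
      simp only [mem_insert, mem_singleton] at hq
      rcases hq with rfl | rfl
      · refine ⟨fun q => ((mR _).1 q).1 rfl, fun q => ?_⟩
        rw [mA] at q
        tauto
      · refine ⟨fun q => H.wT ((mR _).1 q).2.2, fun _ => ?_⟩
        exact ⟨p, pA, (H.pa _ hu.2.2).symm, by simp [t1p.symm, H.pw], by rw [cp, cw]⟩)
  have t1A : t₁ ∉ A ∪ R := by
    rw [mem_union, mA, mR]; tauto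
  obtain ⟨c₃, p3, -⟩ := ext_save (A ∪ R) {t₁} c₂ (by
      rw [Finset.disjoint_singleton_right]; exact t1A) p2 (by
    intro u hu
    rw [mem_singleton] at hu
    subst hu
    have n1 := H.fp _ h₁
    have n2 := H.fw _ h₁
    have n3 : t₂ ≠ f u := fun e => H.fT _ h₁ (e ▸ h₂)
    refine ⟨{w, f u}, ?_, ?_, ?_⟩
    · intro q hq
      simp only [mem_insert, mem_singleton] at hq
      rcases hq with rfl | rfl
      · exact mem_nb.2 (H.wa _ h₁).symm
      · exact mem_nb.2 (H.fa _ h₁)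
    · rw [card_pair n2.symm]
      have := h.deg u
      omega
    · intro q hq
      simp only [mem_insert, mem_singleton] at hq
      rcases hq with rfl | rfl
      · refine ⟨by simpa using t1w.symm, fun _ => ⟨p, mem_union_left _ pA, (H.pa _ h₁).symm,
          by simp [H.pw, n1.symm], ?_⟩⟩
        rw [e2 _ pA, e2 _ wA, cp, cw]
      · refine ⟨by simpa using (H.fa _ h₁).ne', fun _ => ⟨t₂, mem_union_left _ tA, H.cl _ h₁ _ h₂ h12,
          by simp [t2w, n3], ?_⟩⟩
        rw [e2 _ tA, e2 _ fA, ct, co _ (H.fT _ h₁) n1 n2])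
  apply h.nocol c₃
  have : A ∪ R ∪ {t₁} = Finset.univ := by
    ext u
    simp only [mem_univ, iff_true, mem_union, mA, mR, mem_singleton]
    tauto
  rwa [this] at p3

lemma exists_f (h : Crit G k) {T : Finset V} (hT : T.card + 1 = k) {p w : V} (cl : ∀ a ∈ T, ∀ b ∈ T, a ≠ b → G.Adj a b)
    (pT : p ∉ T) (wT : w ∉ T) (pw : p ≠ w) (npw : ¬ G.Adj p w) (pa : ∀ t ∈ T, G.Adj p t)
    (wa : ∀ t ∈ T, G.Adj w t) : ∃ f, TPW G k T p w f := by
  have hk := h.hk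
  have key : ∀ t, ∃ s, t ∈ T → nb G t \ insert p (insert w (T.erase t)) = {s} := by
    intro t
    by_cases ht : t ∈ T
    · have hsub : insert p (insert w (T.erase t)) ⊆ nb G t := by
        intro u hu
        simp only [mem_insert, mem_erase] at hu
        rcases hu with rfl | rfl | hu
        · exact mem_nb.2 (pa t ht).symm
        · exact mem_nb.2 (wa t ht).symm
        · exact mem_nb.2 (cl t ht u hu.2 hu.1.symm)
      have hcard : (insert p (insert w (T.erase t))).card = k := by
        rw [card_insert_of_notMem (by simp [pw, pT]), card_insert_of_notMem (by simp [wT]),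
          card_erase_of_mem ht]
        omega
      have : (nb G t \ insert p (insert w (T.erase t))).card = 1 := by
        rw [card_sdiff_of_subset hsub, hcard, (star h t).1]; omega
      obtain ⟨s, hs⟩ := card_eq_one.1 this
      exact ⟨s, fun _ => hs⟩
    · exact ⟨t, fun q => absurd q ht⟩
  choose f hf using key
  have hf' : ∀ t ∈ T, ∀ u, (G.Adj t u ∧ u ≠ p ∧ u ≠ w ∧ (u ∈ T → u = t)) ↔ u = f t := by
    intro t ht u
    have := congrArg (fun s => u ∈ s) (hf t ht)
    simp only [mem_sdiff, mem_insert, mem_erase, mem_singleton, mem_nb, eq_iff_iff] at this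
    rw [← this]; tauto
  refine ⟨f, hT, cl, pT, wT, pw, npw, pa, wa, fun t ht => ((hf' t ht _).2 rfl).1, ?_,
    fun t ht => ((hf' t ht _).2 rfl).2.1, fun t ht => ((hf' t ht _).2 rfl).2.2.1, ?_⟩
  · intro t ht q
    have := (hf' t ht _).2 rfl
    exact this.1.ne (this.2.2.2 q).symm
  · intro t ht u hu
    by_contra hcon
    push Not at hcon
    exact hcon.2.2.2 ((hf' t ht u).1 ⟨hu, hcon.2.1, hcon.2.2.1, fun q => absurd q hcon.1⟩)

/-- no `K_{k+1}` minus an edge -/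
lemma no_tpw (h : Crit G k) {T : Finset V} (hT : T.card + 1 = k) {p w : V} (cl : ∀ a ∈ T, ∀ b ∈ T, a ≠ b → G.Adj a b)
    (pT : p ∉ T) (wT : w ∉ T) (pw : p ≠ w) (pa : ∀ t ∈ T, G.Adj p t)
    (wa : ∀ t ∈ T, G.Adj w t) : False := by
  have hk := h.hk
  have clq : ∀ a b, a ∉ T → b ∉ T → a ≠ b → (∀ t ∈ T, G.Adj a t) → (∀ t ∈ T, G.Adj b t) →
      ¬ G.Adj a b := by
    intro a b ha hb hab aT bT adj
    have := h.noclq (insert a (insert b T)) (by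
      intro r hr s hs hrs
      simp only [mem_insert] at hr hs
      rcases hr with e | e | hr <;> rcases hs with e' | e' | hs
      · exact absurd (e.trans e'.symm) hrs
      · rw [e, e']; exact adj
      · rw [e]; exact aT s hs
      · rw [e, e']; exact adj.symm
      · exact absurd (e.trans e'.symm) hrs
      · rw [e]; exact bT s hs
      · rw [e']; exact (aT r hr).symm
      · rw [e']; exact (bT r hr).symm
      · exact cl r hr s hs hrs)
    rw [card_insert_of_notMem (by simp [hab, ha]), card_insert_of_notMem hb] at this
    omega
  obtain ⟨f, H⟩ := exists_f h hT cl pT wT pw (clq p w pT wT pw pa wa) pa wa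
  have hpw : ∀ t ∈ T, G.Adj p (f t) ∨ G.Adj w (f t) := by
    intro t ht
    by_contra hcon
    push Not at hcon
    exact hcon.2 (h.claw t p w (f t) (pa t ht).symm (wa t ht).symm (H.fa t ht) pw (H.fp t ht).symm
      (H.fw t ht).symm H.npw hcon.1)
  have hmaps : ∀ t ∈ T, f t ∈ (nb G p \ T ∪ nb G w \ T) := by
    intro t ht
    have := H.fT t ht
    rcases hpw t ht with q | q <;> simp [mem_nb, q, this]
  obtain ⟨t, ht, t', ht', htt, ett⟩ := Finset.exists_ne_map_eq_of_card_lt_of_maps_to (by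
    have a1 := out_card h H.card H.pa
    have a2 := out_card h H.card H.wa
    have a3 := card_union_le (nb G p \ T) (nb G w \ T)
    omega) hmaps
  by_cases hconst : ∀ s ∈ T, f s = f t
  · have hfT : ∀ s ∈ T, G.Adj (f t) s := fun s hs => by
      rw [← hconst s hs]; exact (H.fa s hs).symm
    rcases hpw t ht with q | q
    · exact clq p (f t) pT (H.fT t ht) (H.fp t ht).symm pa hfT q
    · exact clq w (f t) wT (H.fT t ht) (H.fw t ht).symm wa hfT q
  · push Not at hconst
    obtain ⟨s, hs, hst⟩ := hconst
    obtain ⟨c, hc⟩ := any_part h (D := insert p (insert w T)) (d := p) (by simp)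
    by_cases hne : c (f t) = c (f s)
    · -- recolor `f t`
      have hsub : ∃ q, (q = p ∨ q = w) ∧ G.Adj q (f t) := by
        rcases hpw t ht with q | q
        · exact ⟨p, Or.inl rfl, q⟩
        · exact ⟨w, Or.inr rfl, q⟩
      obtain ⟨q, hq, hqf⟩ := hsub
      have hqt : q ∉ T := by rcases hq with rfl | rfl <;> assumption
      have c3 : ({q, t, t'} : Finset V).card = 3 := by
        rw [card_eq_three]
        exact ⟨q, t, t', fun e => hqt (e ▸ ht), fun e => hqt (e ▸ ht'), htt, rfl⟩
      have s3 : ({q, t, t'} : Finset V) ⊆ nb G (f t) := by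
        intro u hu
        simp only [mem_insert, mem_singleton] at hu
        rcases hu with e | e | e
        · rw [e]; exact mem_nb.2 hqf.symm
        · rw [e]; exact mem_nb.2 (H.fa t ht).symm
        · rw [e, ett]; exact mem_nb.2 (H.fa t' ht').symm
      have c4 := card_sdiff_of_subset s3
      have c5 := card_image_le (s := nb G (f t) \ {q, t, t'}) (f := c)
      have c6 := card_insert_le (c (f t)) ((nb G (f t) \ {q, t, t'}).image c)
      have c7 := h.deg (f t)
      have hlt : (insert (c (f t)) ((nb G (f t) \ {q, t, t'}).image c)).card
          < (Finset.univ : Finset (Fin k)).card := by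
        rw [card_univ, Fintype.card_fin]; omega
      obtain ⟨m, -, hm⟩ := Finset.exists_mem_notMem_of_card_lt_card hlt
      rw [mem_insert, not_or] at hm
      have hmu : ∀ u ∈ Finset.univ \ insert p (insert w T), G.Adj (f t) u → c u ≠ m := by
        intro u hu hadj e
        apply hm.2
        refine mem_image.2 ⟨u, ?_, e⟩
        simp only [mem_sdiff, mem_univ, true_and, mem_insert, not_or] at hu
        simp only [mem_sdiff, mem_nb, hadj, true_and, mem_insert, mem_singleton, not_or]
        refine ⟨?_, ?_, ?_⟩
        · rintro rfl
          rcases hq with q | q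
          · exact hu.1 q
          · exact hu.2.1 q
        · rintro rfl; exact hu.2.2 ht
        · rintro rfl; exact hu.2.2 ht'
      refine tpw_col h H (c := Function.update c (f t) m) ?_ ht hs ?_
      · intro a ha b hb hab
        by_cases e1 : a = f t
        · rw [e1, Function.update_self, Function.update_of_ne (by rw [← e1]; exact hab.ne')]
          exact (hmu b hb (e1 ▸ hab)).symm
        · by_cases e2 : b = f t
          · rw [e2, Function.update_self, Function.update_of_ne (by rw [← e2]; exact hab.ne)]
            exact (hmu a ha (e2 ▸ hab.symm))
          · rw [Function.update_of_ne e1, Function.update_of_ne e2]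
            exact hc a ha b hb hab
      · rw [Function.update_self, Function.update_of_ne hst, ← hne]
        exact hm.1
    · exact tpw_col h H hc ht hs hne

lemma two_non (h : Crit G k) {K : Finset V} (hK : K.card = k)
    (cl : ∀ a ∈ K, ∀ b ∈ K, a ≠ b → G.Adj a b) {w : V} (hw : w ∉ K) (q : V)
    (hq : ∀ x ∈ K, x ≠ q → G.Adj w x) : False := by
  have h8 := h.hk
  obtain ⟨a, ha, hqa⟩ : ∃ a ∈ K, ∀ x ∈ K, x ≠ a → G.Adj w x := by
    by_cases hqK : q ∈ K
    · exact ⟨q, hqK, hq⟩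
    · obtain ⟨a, ha⟩ : K.Nonempty := by rw [← card_pos]; omega
      exact ⟨a, ha, fun x hx _ => hq x hx (fun e => hqK (e ▸ hx))⟩
  have hc := card_erase_of_mem ha
  refine no_tpw h (T := K.erase a) (p := a) (w := w) (by omega) ?_ (by simp)
    (fun e => hw (mem_of_mem_erase e)) (fun e => hw (e ▸ ha)) ?_ ?_
  · intro x hx y hy; exact cl x (mem_of_mem_erase hx) y (mem_of_mem_erase hy)
  · intro t ht; exact cl a ha t (mem_of_mem_erase ht) (ne_of_mem_erase ht).symm
  · intro t ht; exact hqa t (mem_of_mem_erase ht) (ne_of_mem_erase ht)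

lemma ext_two (h : Crit G k) {K : Finset V} (hK : K.card = k)
    (cl : ∀ a ∈ K, ∀ b ∈ K, a ≠ b → G.Adj a b) {u : V} (hu : u ∈ K) :
    ∃ y y', y ≠ y' ∧ y ∉ K ∧ y' ∉ K ∧ G.Adj u y ∧ G.Adj u y' ∧ ¬ G.Adj y y' ∧
      (∀ x, G.Adj u x → x ∈ K ∨ x = y ∨ x = y') ∧
      ∀ x ∈ K, G.Adj x y ∨ G.Adj x y' := by
  have h8 := h.hk
  obtain ⟨hdeg, S, p, p', hS, hpp, hnpp, hnb, hScl⟩ := star h u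
  have e1 : nb G u ∩ K = K.erase u := by
    ext x
    simp only [mem_inter, mem_nb, mem_erase]
    constructor
    · rintro ⟨a, b⟩; exact ⟨a.ne', b⟩
    · rintro ⟨a, b⟩; exact ⟨cl u hu x b a.symm, b⟩
  have e2 := card_erase_of_mem hu
  have e3 := card_sdiff_add_card_inter (nb G u) K
  rw [e1] at e3
  have e4 : (nb G u \ K).card = 2 := by omega
  obtain ⟨y, y', hyy, hY⟩ := card_eq_two.1 e4
  have memY : ∀ x, (G.Adj u x ∧ x ∉ K) ↔ (x = y ∨ x = y') := by
    intro x
    have := Finset.ext_iff.1 hY x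
    simpa [mem_nb] using this
  obtain ⟨uy, yK⟩ := (memY y).2 (Or.inl rfl)
  obtain ⟨uy', yK'⟩ := (memY y').2 (Or.inr rfl)
  have memN : ∀ x, G.Adj u x ↔ (x = p ∨ x = p' ∨ x ∈ S) := by
    intro x
    have := Finset.ext_iff.1 hnb x
    simpa [mem_nb] using this
  have key : ∀ z q, z ∉ K → z ∈ S → (∀ x ∈ K, x ≠ u → x ≠ q → x ∈ S) → False := by
    intro z q zK zS hq
    refine two_non h hK cl zK q ?_
    intro x hx hxq
    by_cases e : x = u
    · rw [e]; exact ((memN z).2 (Or.inr (Or.inr zS))).symm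
    · exact hScl z zS x (hq x hx e hxq) (fun e => zK (e ▸ hx))
  have nadj : ¬ G.Adj y y' := by
    intro hadj
    have main : ∀ z z', z ∉ K → z' ∉ K → G.Adj z z' → (z = p ∨ z = p' ∨ z ∈ S) →
        z' ∈ S → False := by
      intro z z' zK zK' hzz hz hz'
      rcases hz with e | e | e
      · apply key z' p' zK' hz'
        intro x hx hxu hxp
        rcases (memN x).1 (cl u hu x hx (Ne.symm hxu)) with e' | e' | e'
        · exact absurd (e ▸ e' ▸ hx) zK
        · exact absurd e' hxp
        · exact e'
      · apply key z' p zK' hz'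
        intro x hx hxu hxp
        rcases (memN x).1 (cl u hu x hx (Ne.symm hxu)) with e' | e' | e'
        · exact absurd e' hxp
        · exact absurd (e ▸ e' ▸ hx) zK
        · exact e'
      · by_cases hp : p ∈ K
        · have hp' : p' ∉ K := fun hp' => hnpp (cl p hp p' hp' hpp)
          apply key z' p zK' hz'
          intro x hx hxu hxp
          rcases (memN x).1 (cl u hu x hx (Ne.symm hxu)) with e' | e' | e'
          · exact absurd e' hxp
          · exact absurd (e' ▸ hx) hp'
          · exact e'
        · apply key z' p' zK' hz'
          intro x hx hxu hxp
          rcases (memN x).1 (cl u hu x hx (Ne.symm hxu)) with e' | e' | e'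
          · exact absurd (e' ▸ hx) hp
          · exact absurd e' hxp
          · exact e'
    have m1 := (memN y).1 uy
    have m2 := (memN y').1 uy'
    by_cases s1 : y ∈ S
    · exact main y' y yK' yK hadj.symm m2 s1
    · by_cases s2 : y' ∈ S
      · exact main y y' yK yK' hadj m1 s2
      · have hs := hadj.symm
        rcases m1 with e | e | e <;> rcases m2 with e' | e' | e' <;> simp_all
  refine ⟨y, y', hyy, yK, yK', uy, uy', nadj, ?_, ?_⟩
  · intro x hx
    by_cases hxK : x ∈ K
    · exact Or.inl hxK
    · exact Or.inr ((memY x).1 ⟨hx, hxK⟩)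
  · intro x hx
    by_contra hcon
    rw [not_or] at hcon
    by_cases e : x = u
    · rw [e] at hcon; exact hcon.1 uy
    · exact nadj (h.claw u x y y' (cl u hu x hx (Ne.symm e)) uy uy' (fun e => yK (e ▸ hx))
        (fun e => yK' (e ▸ hx)) hyy hcon.1 hcon.2)

lemma two_non_ex (h : Crit G k) {K : Finset V} (hK : K.card = k)
    (cl : ∀ a ∈ K, ∀ b ∈ K, a ≠ b → G.Adj a b) {w : V} (hw : w ∉ K) :
    ∃ a ∈ K, ∃ b ∈ K, a ≠ b ∧ ¬ G.Adj a w ∧ ¬ G.Adj b w := by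
  obtain ⟨a, ha, hna⟩ : ∃ a ∈ K, ¬ G.Adj a w := by
    by_contra hcon
    push Not at hcon
    exact two_non h hK cl hw w (fun x hx _ => (hcon x hx).symm)
  by_contra hcon
  push Not at hcon
  exact two_non h hK cl hw a (fun x hx hxa => (hcon a ha x hx hxa.symm hna).symm)

lemma four (h : Crit G k) {K : Finset V} (hK : K.card = k)
    (cl : ∀ a ∈ K, ∀ b ∈ K, a ≠ b → G.Adj a b) {x y z : V} (hy : y ∉ K) (hz : z ∉ K)
    (xy : ∀ u ∈ K, G.Adj u x ∨ G.Adj u y) (xz : ∀ u ∈ K, G.Adj u x ∨ G.Adj u z)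
    (yz : ∀ u ∈ K, G.Adj u y ∨ G.Adj u z) : (nb G x \ K).card + 3 ≤ k := by
  obtain ⟨a, ha, b, hb, hab, na, nb'⟩ := two_non_ex h hK cl hy
  obtain ⟨c, hc, d, hd, hcd, nc, nd⟩ := two_non_ex h hK cl hz
  have az := (yz a ha).resolve_left na
  have bz := (yz b hb).resolve_left nb'
  have ax := (xy a ha).resolve_right na
  have bx := (xy b hb).resolve_right nb'
  have cx := (xz c hc).resolve_right nc
  have dx := (xz d hd).resolve_right nd
  have h4 : ({a, b, c, d} : Finset V).card = 4 := by
    have h1 : a ≠ c := fun e => nc (e ▸ az)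
    have h2 : a ≠ d := fun e => nd (e ▸ az)
    have h3 : b ≠ c := fun e => nc (e ▸ bz)
    have h4 : b ≠ d := fun e => nd (e ▸ bz)
    simp [*]
  have hs : ({a, b, c, d} : Finset V) ⊆ nb G x ∩ K := by
    intro u hu
    simp only [mem_insert, mem_singleton] at hu
    rw [mem_inter, mem_nb]
    rcases hu with e | e | e | e <;> rw [e]
    · exact ⟨ax.symm, ha⟩
    · exact ⟨bx.symm, hb⟩
    · exact ⟨cx.symm, hc⟩
    · exact ⟨dx.symm, hd⟩
  have := card_le_card hs
  have e3 := card_sdiff_add_card_inter (nb G x) K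
  have := h.deg x
  have := h.hk
  omega

/-- The final configuration. -/
structure Fin3 (G : SimpleGraph V) (K : Finset V) (w1 w2 w3 u1 u2 u3 : V) : Prop where
  w12 : w1 ≠ w2
  w13 : w1 ≠ w3
  w23 : w2 ≠ w3
  k1 : w1 ∉ K
  k2 : w2 ∉ K
  k3 : w3 ∉ K
  n12 : ¬ G.Adj w1 w2
  n13 : ¬ G.Adj w1 w3
  n23 : ¬ G.Adj w2 w3
  m1 : u1 ∈ K
  m2 : u2 ∈ K
  m3 : u3 ∈ K
  a1 : ¬ G.Adj u1 w3
  a2 : ¬ G.Adj u2 w1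
  a3 : ¬ G.Adj u3 w2
  ex : ∀ u ∈ K, ∀ x, G.Adj u x → x ∈ K ∨ x = w1 ∨ x = w2 ∨ x = w3
  o12 : ∀ u ∈ K, G.Adj u w1 ∨ G.Adj u w2
  o13 : ∀ u ∈ K, G.Adj u w1 ∨ G.Adj u w3
  o23 : ∀ u ∈ K, G.Adj u w2 ∨ G.Adj u w3

lemma pick (c : V → Fin k) (N : Finset V) (hN : N.card + 3 ≤ k) (a b : Fin k) :
    ∃ m, m ≠ a ∧ m ≠ b ∧ ∀ x ∈ N, c x ≠ m := by
  have c1 := card_image_le (s := N) (f := c)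
  have c2 := card_insert_le a (insert b (N.image c))
  have c3 := card_insert_le b (N.image c)
  have hlt : (insert a (insert b (N.image c))).card < (Finset.univ : Finset (Fin k)).card := by
    rw [card_univ, Fintype.card_fin]; omega
  obtain ⟨m, -, hm⟩ := Finset.exists_mem_notMem_of_card_lt_card hlt
  simp only [mem_insert, not_or, mem_image, not_exists, not_and] at hm
  exact ⟨m, hm.1, hm.2.1, hm.2.2⟩

lemma pc_insert {A : Finset V} {c : V → Fin k} (hp : PC G A c) {x : V} (hx : x ∉ A) {m : Fin k}
    (hm : ∀ a ∈ A, G.Adj x a → c a ≠ m) : PC G (insert x A) (Function.update c x m) := by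
  intro a ha b hb hab
  have hne : ∀ a ∈ A, a ≠ x := fun a ha e => hx (e ▸ ha)
  rcases mem_insert.1 ha with rfl | ha' <;> rcases mem_insert.1 hb with rfl | hb'
  · exact absurd hab (G.loopless.irrefl _)
  · rw [Function.update_self, Function.update_of_ne (hne b hb')]
    exact (hm b hb' hab).symm
  · rw [Function.update_self, Function.update_of_ne (hne a ha')]
    exact hm a ha' hab.symm
  · rw [Function.update_of_ne (hne a ha'), Function.update_of_ne (hne b hb')]
    exact hp a ha' b hb' hab

lemma fin3 (h : Crit G k) {K : Finset V} (hK : K.card = k)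
    (cl : ∀ a ∈ K, ∀ b ∈ K, a ≠ b → G.Adj a b) {w1 w2 w3 u1 u2 u3 : V}
    (F : Fin3 G K w1 w2 w3 u1 u2 u3) : False := by
  obtain ⟨w12, w13, w23, k1, k2, k3, n12, n13, n23, m1, m2, m3, a1, a2, a3, ex, o12, o13, o23⟩ := F
  have h8 := h.hk
  have u11 := (o13 u1 m1).resolve_right a1
  have u12 := (o23 u1 m1).resolve_right a1
  have u22 := (o12 u2 m2).resolve_left a2
  have u23 := (o13 u2 m2).resolve_left a2
  have u31 := (o12 u3 m3).resolve_right a3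
  have u33 := (o23 u3 m3).resolve_left a3
  have v12 : u1 ≠ u2 := fun e => a2 (e ▸ u11)
  have v13 : u1 ≠ u3 := fun e => a3 (e ▸ u12)
  have v23 : u2 ≠ u3 := fun e => a3 (e ▸ u22)
  have f1 := four h hK cl k2 k3 o12 o13 o23
  have f2 := four h hK cl k1 k3 (fun u hu => (o12 u hu).symm) o23 o13
  have f3 := four h hK cl k1 k2 (fun u hu => (o13 u hu).symm) (fun u hu => (o23 u hu).symm) o12
  obtain ⟨c, hc⟩ := any_part h (D := insert w1 (insert w2 (insert w3 K))) (d := w1) (by simp)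
  set A0 := Finset.univ \ insert w1 (insert w2 (insert w3 K)) with hA0
  have mA0 : ∀ x, x ∈ A0 ↔ (x ≠ w1 ∧ x ≠ w2 ∧ x ≠ w3 ∧ x ∉ K) := by
    intro x; simp [hA0]
  obtain ⟨b1, -, -, hb1⟩ := pick c _ f1 (c w1) (c w1)
  obtain ⟨b2, b21, -, hb2⟩ := pick c _ f2 b1 b1
  obtain ⟨b3, b31, b32, hb3⟩ := pick c _ f3 b1 b2
  have hn1 : ∀ x ∈ A0, G.Adj w1 x → c x ≠ b1 := fun x hx hax =>
    hb1 x (mem_sdiff.2 ⟨mem_nb.2 hax, ((mA0 x).1 hx).2.2.2⟩)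
  have hn2 : ∀ x ∈ A0, G.Adj w2 x → c x ≠ b2 := fun x hx hax =>
    hb2 x (mem_sdiff.2 ⟨mem_nb.2 hax, ((mA0 x).1 hx).2.2.2⟩)
  have hn3 : ∀ x ∈ A0, G.Adj w3 x → c x ≠ b3 := fun x hx hax =>
    hb3 x (mem_sdiff.2 ⟨mem_nb.2 hax, ((mA0 x).1 hx).2.2.2⟩)
  have hnK : ∀ u ∈ K, ∀ x ∈ A0, ¬ G.Adj u x := by
    intro u hu x hx hux
    have := (mA0 x).1 hx
    have := ex u hu x hux
    tauto
  have i1 : w1 ∉ A0 := fun e => ((mA0 _).1 e).1 rfl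
  have i2 : w2 ∉ A0 := fun e => ((mA0 _).1 e).2.1 rfl
  have i3 : w3 ∉ A0 := fun e => ((mA0 _).1 e).2.2.1 rfl
  have iK : ∀ u ∈ K, u ∉ A0 := fun u hu e => ((mA0 _).1 e).2.2.2 hu
  have ne : ∀ u ∈ K, ∀ w, w ∉ K → u ≠ w := fun u hu w hw e => hw (e ▸ hu)
  let c' : V → Fin k := fun x => if x = w1 then b1 else if x = w2 then b2 else if x = w3 then b3
    else if x = u1 then b3 else if x = u2 then b1 else if x = u3 then b2 else c x
  have cw1 : c' w1 = b1 := by simp [c']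
  have cw2 : c' w2 = b2 := by simp [c', w12.symm]
  have cw3 : c' w3 = b3 := by simp [c', w13.symm, w23.symm]
  have cu1 : c' u1 = b3 := by
    simp [c', ne u1 m1 w1 k1, ne u1 m1 w2 k2, ne u1 m1 w3 k3]
  have cu2 : c' u2 = b1 := by
    simp [c', ne u2 m2 w1 k1, ne u2 m2 w2 k2, ne u2 m2 w3 k3, v12.symm]
  have cu3 : c' u3 = b2 := by
    simp [c', ne u3 m3 w1 k1, ne u3 m3 w2 k2, ne u3 m3 w3 k3, v13.symm, v23.symm]
  have cA : ∀ x ∈ A0, c' x = c x := by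
    intro x hx
    obtain ⟨q1, q2, q3, q4⟩ := (mA0 x).1 hx
    have q5 : x ≠ u1 := fun e => q4 (e ▸ m1)
    have q6 : x ≠ u2 := fun e => q4 (e ▸ m2)
    have q7 : x ≠ u3 := fun e => q4 (e ▸ m3)
    simp [c', q1, q2, q3, q5, q6, q7]
  let R := K \ {u1, u2, u3}
  have mR : ∀ x, x ∈ R ↔ (x ∈ K ∧ x ≠ u1 ∧ x ≠ u2 ∧ x ≠ u3) := by
    intro x; simp [R]
  have mA : ∀ x, x ∈ Finset.univ \ R →
      x ∈ A0 ∨ x = w1 ∨ x = w2 ∨ x = w3 ∨ x = u1 ∨ x = u2 ∨ x = u3 := by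
    intro x hx
    simp only [mem_sdiff, mem_univ, true_and, mR] at hx
    rw [mA0]
    tauto
  have hlt : ∀ a ∈ A0, ∀ b, (b = w1 ∨ b = w2 ∨ b = w3 ∨ b = u1 ∨ b = u2 ∨ b = u3) →
      G.Adj b a → c' b ≠ c' a := by
    intro a ha b hb hab
    rw [cA a ha]
    rcases hb with e | e | e | e | e | e <;> rw [e] at hab ⊢
    · rw [cw1]; exact (hn1 a ha hab).symm
    · rw [cw2]; exact (hn2 a ha hab).symm
    · rw [cw3]; exact (hn3 a ha hab).symm
    · exact absurd hab (hnK _ m1 a ha)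
    · exact absurd hab (hnK _ m2 a ha)
    · exact absurd hab (hnK _ m3 a ha)
  have hPC : PC G (Finset.univ \ R) c' := by
    intro a ha b hb hab
    rcases mA a ha with ha' | ha'
    · rcases mA b hb with hb' | hb'
      · rw [cA a ha', cA b hb']; exact hc a ha' b hb' hab
      · exact (hlt a ha' b hb' hab.symm).symm
    · rcases mA b hb with hb' | hb'
      · exact hlt b hb' a ha' hab
      · have n12' := mt SimpleGraph.Adj.symm n12
        have n13' := mt SimpleGraph.Adj.symm n13
        have n23' := mt SimpleGraph.Adj.symm n23
        have a1' := mt SimpleGraph.Adj.symm a1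
        have a2' := mt SimpleGraph.Adj.symm a2
        have a3' := mt SimpleGraph.Adj.symm a3
        have irr : ∀ x, ¬ G.Adj x x := fun x => G.loopless.irrefl x
        rcases ha' with e | e | e | e | e | e <;> rcases hb' with e' | e' | e' | e' | e' | e' <;>
          rw [e, e'] at hab ⊢ <;>
          simp only [cw1, cw2, cw3, cu1, cu2, cu3] <;>
          first
          | exact absurd hab (irr _)
          | exact absurd hab (by assumption)
          | exact b21
          | exact b31
          | exact b32
          | exact b21.symm
          | exact b31.symm
          | exact b32.symm
  have hR3 : ∀ x, (x = w1 ∨ x = w2 ∨ x = w3) → x ∉ R := by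
    rintro x (e | e | e) hx <;> rw [e] at hx
    · exact k1 ((mR _).1 hx).1
    · exact k2 ((mR _).1 hx).1
    · exact k3 ((mR _).1 hx).1
  have rep : ∀ u ∈ R, ∀ x, (x = w1 ∨ x = w2 ∨ x = w3) →
      ∃ a ∈ Finset.univ \ R, G.Adj u a ∧ a ∈ K ∧ c' a = c' x := by
    intro u hu x hx
    obtain ⟨uK, p1, p2, p3⟩ := (mR u).1 hu
    rcases hx with e | e | e <;> rw [e]
    · exact ⟨u2, by simp [mR], cl u uK u2 m2 p2, m2, by rw [cw1, cu2]⟩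
    · exact ⟨u3, by simp [mR], cl u uK u3 m3 p3, m3, by rw [cw2, cu3]⟩
    · exact ⟨u1, by simp [mR], cl u uK u1 m1 p1, m1, by rw [cw3, cu1]⟩
  have build : ∀ u ∈ R, ∀ x y, (x = w1 ∨ x = w2 ∨ x = w3) → (y = w1 ∨ y = w2 ∨ y = w3) → x ≠ y →
      G.Adj u x → G.Adj u y → ∃ Q, Q ⊆ nb G u ∧ (nb G u).card < k + Q.card ∧
      ∀ q ∈ Q, q ∉ R ∧ (q ∈ Finset.univ \ R → ∃ a ∈ Finset.univ \ R, G.Adj u a ∧ a ∉ Q ∧ c' a = c' q) := by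
    intro u hu x y hx hy hxy ux uy
    refine ⟨{x, y}, ?_, ?_, ?_⟩
    · intro z hz
      simp only [mem_insert, mem_singleton] at hz
      rcases hz with e | e <;> rw [e, mem_nb] <;> assumption
    · rw [card_pair hxy]; have := h.deg u; omega
    · intro q hq
      simp only [mem_insert, mem_singleton] at hq
      have hq' : q = w1 ∨ q = w2 ∨ q = w3 := by rcases hq with e | e <;> rw [e] <;> assumption
      refine ⟨hR3 q hq', fun _ => ?_⟩
      obtain ⟨a, ha, hua, haK, hca⟩ := rep u hu q hq'
      refine ⟨a, ha, hua, ?_, hca⟩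
      have wK : ∀ x, (x = w1 ∨ x = w2 ∨ x = w3) → x ∉ K := by
        rintro x (e | e | e) <;> rw [e] <;> assumption
      simp only [mem_insert, mem_singleton, not_or]
      exact ⟨fun e => wK x hx (e ▸ haK), fun e => wK y hy (e ▸ haK)⟩
  obtain ⟨c'', hc'', -⟩ := ext_save (Finset.univ \ R) R c' sdiff_disjoint hPC (by
    intro u hu
    have uK := ((mR u).1 hu).1
    by_cases q1 : G.Adj u w1
    · rcases o23 u uK with q | q
      · exact build u hu w1 w2 (by simp) (by simp) w12 q1 q
      · exact build u hu w1 w3 (by simp) (by simp) w13 q1 q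
    · exact build u hu w2 w3 (by simp) (by simp) w23 ((o12 u uK).resolve_left q1)
        ((o13 u uK).resolve_left q1))
  refine h.nocol c'' ?_
  intro a _ b _ hab
  exact hc'' a (by by_cases e : a ∈ R <;> simp [e]) b (by by_cases e : b ∈ R <;> simp [e]) hab

lemma crit_false (h : Crit G k) (v : V) : False := by
  have h8 := h.hk
  obtain ⟨hdeg, S, p, p', hS, hpp, hnpp, hnb, hScl⟩ := star h v
  have vS : ∀ s ∈ S, G.Adj v s := by
    intro s hs
    rw [← mem_nb, hnb]; simp [hs]
  have hvS : v ∉ S := fun e => G.loopless.irrefl _ (vS v e)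
  obtain ⟨K, hKd⟩ : ∃ K, K = insert v S := ⟨_, rfl⟩
  have hK : K.card = k := by rw [hKd, card_insert_of_notMem hvS]; exact hS
  have cl : ∀ a ∈ K, ∀ b ∈ K, a ≠ b → G.Adj a b := by
    intro a ha b hb hab
    rw [hKd, mem_insert] at ha hb
    rcases ha with e | ha <;> rcases hb with e' | hb
    · exact absurd (e.trans e'.symm) hab
    · rw [e]; exact vS b hb
    · rw [e']; exact (vS a ha).symm
    · exact hScl a ha b hb hab
  have m1 : v ∈ K := by rw [hKd]; simp
  obtain ⟨w1, w2, w12, k1, k2, c11, c12, n12, x1, o12⟩ := ext_two h hK cl m1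
  obtain ⟨u2, m2, -, -, -, a2, -⟩ := two_non_ex h hK cl k1
  have c22 := (o12 u2 m2).resolve_left a2
  obtain ⟨w3, w23, k3, c23, n23, x2, o23⟩ : ∃ w3, w2 ≠ w3 ∧ w3 ∉ K ∧ G.Adj u2 w3 ∧ ¬ G.Adj w2 w3 ∧
      (∀ x, G.Adj u2 x → x ∈ K ∨ x = w2 ∨ x = w3) ∧ ∀ x ∈ K, G.Adj x w2 ∨ G.Adj x w3 := by
    obtain ⟨y, y', hyy, yK, yK', uy, uy', nyy, hx, ho⟩ := ext_two h hK cl m2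
    rcases hx w2 c22 with e | e | e
    · exact absurd e k2
    · rw [e]; exact ⟨y', hyy, yK', uy', nyy, hx, ho⟩
    · rw [e]; exact ⟨y, hyy.symm, yK, uy, fun q => nyy q.symm, fun x q =>
        (hx x q).imp_right Or.symm, fun x q => (ho x q).symm⟩
  have w13 : w1 ≠ w3 := fun e => a2 (e ▸ c23)
  obtain ⟨u3, m3, -, -, -, a3, -⟩ := two_non_ex h hK cl k2
  have c31 := (o12 u3 m3).resolve_right a3
  have c33 := (o23 u3 m3).resolve_left a3
  obtain ⟨n13, o13⟩ : ¬ G.Adj w1 w3 ∧ ∀ x ∈ K, G.Adj x w1 ∨ G.Adj x w3 := by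
    obtain ⟨y, y', hyy, yK, yK', uy, uy', nyy, hx, ho⟩ := ext_two h hK cl m3
    rcases hx w1 c31 with e | e | e
    · exact absurd e k1
    · rcases hx w3 c33 with e' | e' | e'
      · exact absurd e' k3
      · exact absurd (e.trans e'.symm) w13
      · rw [e, e']; exact ⟨nyy, ho⟩
    · rcases hx w3 c33 with e' | e' | e'
      · exact absurd e' k3
      · rw [e, e']; exact ⟨fun q => nyy q.symm, fun x q => (ho x q).symm⟩
      · exact absurd (e.trans e'.symm) w13
  refine fin3 h hK cl (w1 := w1) (w2 := w2) (w3 := w3) (u1 := v) (u2 := u2) (u3 := u3)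
    ⟨w12, w13, w23, k1, k2, k3, n12, n13, n23, m1, m2, m3, ?_, a2, a3, ?_, o12, o13, o23⟩
  · intro q
    rcases x1 w3 q with e | e | e
    · exact k3 e
    · exact w13 e.symm
    · exact w23 e.symm
  · intro u hu x hux
    obtain ⟨y, y', hyy, yK, yK', uy, uy', nyy, hx, ho⟩ := ext_two h hK cl hu
    have q12 := o12 u hu
    have q13 := o13 u hu
    have q23 := o23 u hu
    have two : ∀ a b, a ∉ K → b ∉ K → a ≠ b → G.Adj u a → G.Adj u b → x ∈ K ∨ x = a ∨ x = b := by
      intro a b aK bK hab ua ub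
      have r1 := hx a ua
      have r2 := hx b ub
      have r3 := hx x hux
      rcases r1 with r1 | r1 | r1
      · exact absurd r1 aK
      · rcases r2 with r2 | r2 | r2
        · exact absurd r2 bK
        · exact absurd (r1.trans r2.symm) hab
        · rw [r1, r2]; exact r3
      · rcases r2 with r2 | r2 | r2
        · exact absurd r2 bK
        · rw [r1, r2]; exact r3.imp_right Or.symm
        · exact absurd (r1.trans r2.symm) hab
    by_cases q1 : G.Adj u w1
    · rcases q23 with q | q
      · exact (two w1 w2 k1 k2 w12 q1 q).imp_right (Or.imp_right Or.inl)
      · exact (two w1 w3 k1 k3 w13 q1 q).imp_right (Or.imp_right Or.inr)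
    · exact (two w2 w3 k2 k3 w23 (q12.resolve_left q1) (q13.resolve_left q1)).imp_right Or.inr

theorem main (k : ℕ) (hk : 8 ≤ k) : ∀ (n : ℕ) (V : Type*) [Fintype V] (G : SimpleGraph V),
    Fintype.card V = n →
    (∀ a b c d, G.Adj a b → G.Adj a c → G.Adj a d → b ≠ c → b ≠ d → c ≠ d →
      ¬ G.Adj b c → ¬ G.Adj b d → G.Adj c d) →
    (∀ v, (nb G v).card ≤ k + 1) →
    (∀ s : Finset V, (∀ a ∈ s, ∀ b ∈ s, a ≠ b → G.Adj a b) → s.card ≤ k) →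
    ∃ c : V → Fin k, PC G Finset.univ c := by
  intro n
  induction n with
  | zero =>
    intro V _ G hV _ _ _
    have := Fintype.card_eq_zero_iff.1 hV
    exact ⟨fun v => (this.false v).elim, fun v => (this.false v).elim⟩
  | succ n ih =>
    intro V _ G hV hcl hdeg hclq
    by_contra hno
    push Not at hno
    obtain ⟨v0⟩ : Nonempty V := by rw [← Fintype.card_pos_iff]; omega
    refine crit_false (G := G) (k := k) ⟨hk, hcl, hdeg, hno, ?_, hclq⟩ v0
    intro v
    obtain ⟨c, hc⟩ := ih {u : V // u ≠ v} (G.comap Subtype.val)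
      (by rw [Fintype.card_subtype_compl, hV]; simp)
      (fun a b c d ab ac ad h1 h2 h3 n1 n2 => hcl a.1 b.1 c.1 d.1 ab ac ad
        (fun e => h1 (Subtype.ext e)) (fun e => h2 (Subtype.ext e)) (fun e => h3 (Subtype.ext e))
        n1 n2)
      (by
        intro u
        refine le_trans ?_ (hdeg u.1)
        rw [← card_map (Function.Embedding.subtype _)]
        apply card_le_card
        intro x hx
        simp only [mem_map, mem_nb] at hx
        obtain ⟨y, hy, rfl⟩ := hx
        exact mem_nb.2 hy)
      (by
        intro s hs
        rw [← card_map (Function.Embedding.subtype _)]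
        apply hclq
        intro a ha b hb hab
        obtain ⟨x, hx, rfl⟩ := mem_map.1 ha
        obtain ⟨y, hy, rfl⟩ := mem_map.1 hb
        exact hs x hx y hy (fun e => hab (by rw [e])))
    refine ⟨fun x => if hx : x = v then ⟨0, by omega⟩ else c ⟨x, hx⟩, ?_⟩
    intro a b ha hb hab
    simp only [ha, hb, dif_neg, not_false_eq_true]
    exact hc ⟨a, ha⟩ (mem_univ _) ⟨b, hb⟩ (mem_univ _) hab

end BK

theorem borodin_kostochka_claw_free
    {V : Type*} [Fintype V]
    (G : SimpleGraph V) [DecidableRel G.Adj]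
    (hΔ : 9 ≤ G.maxDegree)
    (hfree : ¬ Nonempty (clawGraph ↪g G)) :
    G.chromaticNumber ≤ (↑(max (G.maxDegree - 1) G.cliqueNum) : ℕ∞) := by
  have h1 := le_max_left (G.maxDegree - 1) G.cliqueNum
  have h2 := le_max_right (G.maxDegree - 1) G.cliqueNum
  obtain ⟨c, hc⟩ := BK.main (max (G.maxDegree - 1) G.cliqueNum) (by omega) _ V G rfl
    (by
      intro a b c d ab ac ad bc bd cd nbc nbd
      by_contra ncd
      apply hfree
      have sbc := mt SimpleGraph.Adj.symm nbc
      have sbd := mt SimpleGraph.Adj.symm nbd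
      have scd := mt SimpleGraph.Adj.symm ncd
      refine ⟨⟨⟨![a, b, c, d], ?_⟩, ?_⟩⟩
      · intro i j hij
        have q1 := ab.ne
        have q2 := ac.ne
        have q3 := ad.ne
        fin_cases i <;> fin_cases j <;> simp_all [eq_comm]
      · intro i j
        change G.Adj (![a, b, c, d] i) (![a, b, c, d] j) ↔ _
        fin_cases i <;> fin_cases j <;>
          simp [clawGraph, ab, ac, ad, ab.symm, ac.symm, ad.symm, nbc, nbd, ncd, sbc, sbd, scd])
    (by
      intro v
      have h3 : (BK.nb G v).card = G.degree v := by
        rw [← G.card_neighborFinset_eq_degree]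
        congr 1
        ext u
        simp [BK.mem_nb]
      have := G.degree_le_maxDegree v
      omega)
    (by
      intro s hs
      refine le_trans (SimpleGraph.IsClique.card_le_cliqueNum (tc := ?_)) h2
      intro a ha b hb hab
      exact hs a ha b hb hab)
  exact SimpleGraph.Colorable.chromaticNumber_le
    ⟨SimpleGraph.Coloring.mk c (fun {a b} hab => hc a (Finset.mem_univ _) b (Finset.mem_univ _) hab)⟩
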